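/- arXiv:1503.05987 — 2 statements merged into one kernel-verified Lean document; each statement's English description precedes it below -/
import Mathlib

section
/- Let (X_i)_{i∈ℤ} be a strictly stationary reversible real-valued Markov chain, let f_n be real measurable functions, and set X_{n,k} = f_n(X_k). Assume: (i) E X_{n,k}⁴ < ∞, E X_{n,k} = 0, and E(X_{n,0}²) → σ² as n → ∞; (ii) cov(X_{n,0}, X_{n,2}) + ∑_{k=2}^n cov(X_{n,0}, X_{n,k}) → 0; (iii) (1/n)( var(X_{n,0}²) + ∑_{u=0}^n cov(X_{n,0}², X_{n,u}²) ) → 0. Then (1/√n) ∑_{k=1}^n X_{n,k} converges in distribution to the normal law N(0, σ²). -/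
open MeasureTheory ProbabilityTheory Filter

noncomputable section

/-- The sigma-algebra generated by the past of the process up to time `k`. -/
def pastSigma {Ω : Type*} [MeasurableSpace Ω] (X : ℤ → Ω → ℝ) (k : ℤ) : MeasurableSpace Ω :=
  ⨆ j : ℤ, ⨆ _ : j ≤ k, MeasurableSpace.comap (X j) inferInstance

/-- A strictly stationary, reversible, real-valued Markov chain indexed by `ℤ`. -/
structure IsStationaryReversibleMarkov {Ω : Type*} [MeasurableSpace Ω]
    (μ : Measure Ω) (X : ℤ → Ω → ℝ) : Prop where
  meas : ∀ n, Measurable (X n)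
  stationary : ∀ n : ℤ,
    μ.map (fun ω => fun k : ℤ => X (k + n) ω) = μ.map (fun ω => fun k : ℤ => X k ω)
  reversible : μ.map (fun ω => (X 0 ω, X 1 ω)) = μ.map (fun ω => (X 1 ω, X 0 ω))
  markov : ∀ (n : ℤ) (g : ℝ → ℝ), Measurable g → (∀ x, |g x| ≤ 1) →
    (μ[(fun ω => g (X (n + 1) ω)) | pastSigma X n]
      =ᵐ[μ] μ[(fun ω => g (X (n + 1) ω)) | MeasurableSpace.comap (X n) inferInstance])

/-- Condition C on the kernel `K`. -/
structure ConditionC (K : ℝ → ℝ) : Prop where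
  symm : ∀ x, K (-x) = K x
  antitone : AntitoneOn K (Set.Ioi (0 : ℝ))
  int_one : ∫ u, K u = 1
  decay : Tendsto (fun x => x ^ 2 * K x) atTop (nhds 0)
  diff : Differentiable ℝ K
  deriv_bdd : ∃ C, ∀ x, |deriv K x| ≤ C

/-- `H_k(u,v) = P(X_0 > u, X_k > v) - P(X_0 > u) P(X_k > v)`. -/
def Hcoef {Ω : Type*} [MeasurableSpace Ω] (μ : Measure Ω) (X : ℤ → Ω → ℝ)
    (k : ℤ) (u v : ℝ) : ℝ :=
  (μ {ω | u < X 0 ω ∧ v < X k ω}).toReal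
    - (μ {ω | u < X 0 ω}).toReal * (μ {ω | v < X k ω}).toReal

/-- `η_k = ∫∫ |H_k(u,v)| du dv`. -/
def etaCoef {Ω : Type*} [MeasurableSpace Ω] (μ : Measure Ω) (X : ℤ → Ω → ℝ) (k : ℤ) : ℝ :=
  ∫ u : ℝ, ∫ v : ℝ, |Hcoef μ X k u v|

/-- A function slowly varying at infinity. -/
def SlowlyVaryingAtTop (l : ℝ → ℝ) : Prop :=
  ∀ c : ℝ, 0 < c → Tendsto (fun x => l (c * x) / l x) atTop (nhds 1)

/-- The Rosenblatt kernel density estimator. -/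
def kde {Ω : Type*} (X : ℤ → Ω → ℝ) (K : ℝ → ℝ) (b : ℕ → ℝ) (n : ℕ) (x : ℝ) (ω : Ω) : ℝ :=
  (1 / (n * b n)) * ∑ k ∈ Finset.Icc 1 n, K ((x - X (k : ℤ) ω) / b n)

/-- Covariance of two real random variables. -/
def covR {Ω : Type*} [MeasurableSpace Ω] (μ : Measure Ω) (Y Z : Ω → ℝ) : ℝ :=
  ∫ ω, Y ω * Z ω ∂μ - (∫ ω, Y ω ∂μ) * (∫ ω, Z ω ∂μ)

theorem sum_range_two_mul_add_nonneg {d : ℕ → ℝ} (he : ∀ j, 0 ≤ d (2 * j))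
    (ho : ∀ j, 0 ≤ d (2 * j) + d (2 * j + 1)) (m j : ℕ) :
    0 ≤ ∑ k ∈ Finset.range m, d (2 * j + k) := by
  induction m using Nat.strong_induction_on generalizing j with
  | _ m ih =>
    match m with
    | 0 => simp
    | 1 => simpa using he j
    | m + 2 =>
      have h := ih m (by omega) (j + 1)
      rw [Finset.sum_range_succ', Finset.sum_range_succ']
      have e : ∀ k, d (2 * j + (k + 1 + 1)) = d (2 * (j + 1) + k) := fun k => by
        congr 1; ring
      simp only [e]
      have := ho j
      simp only [zero_add, add_zero] at *
      linarith

theorem neg_le_sum_range_add {d : ℕ → ℝ} (he : ∀ j, 0 ≤ d (2 * j))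
    (ho : ∀ j, 0 ≤ d (2 * j) + d (2 * j + 1)) (hb : ∀ k, |d k| ≤ d 0) (a m : ℕ) :
    -d 0 ≤ ∑ k ∈ Finset.range m, d (a + k) := by
  have h0 : 0 ≤ d 0 := he 0
  rcases Nat.even_or_odd' a with ⟨j, rfl | rfl⟩
  · linarith [sum_range_two_mul_add_nonneg he ho m j]
  · match m with
    | 0 => simpa using h0
    | m + 1 =>
      have h := sum_range_two_mul_add_nonneg he ho m (j + 1)
      rw [Finset.sum_range_succ']
      have e : ∀ k, d (2 * j + 1 + (k + 1)) = d (2 * (j + 1) + k) := fun k => by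
        congr 1; ring
      simp only [e, add_zero]
      linarith [neg_le_of_abs_le (hb (2 * j + 1))]

theorem norm_sum_range_sq_le {H : Type*} [NormedAddCommGroup H] [InnerProductSpace ℝ H]
    {v : ℕ → H} {d : ℕ → ℝ} (hv : ∀ i k, inner ℝ (v i) (v (i + k)) = d k)
    (he : ∀ j, 0 ≤ d (2 * j)) (ho : ∀ j, 0 ≤ d (2 * j) + d (2 * j + 1))
    (hb : ∀ k, |d k| ≤ d 0) {n L : ℕ} (hn : n ≤ L + 1) :
    ‖∑ i ∈ Finset.range n, v i‖ ^ 2 ≤ n * (2 * (d 0 + ∑ k ∈ Finset.range L, d k)) := by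
  have h0 : 0 ≤ d 0 := he 0
  have hs : ∀ m, m ≤ L + 1 →
      ∑ k ∈ Finset.range m, d k ≤ d 0 + ∑ k ∈ Finset.range L, d k := by
    intro m hm
    rcases Nat.lt_or_ge L m with h | h
    · obtain rfl : m = L + 1 := by omega
      rw [Finset.sum_range_succ]
      linarith [le_of_abs_le (hb L)]
    · obtain ⟨r, rfl⟩ := Nat.exists_eq_add_of_le h
      rw [Finset.sum_range_add]
      linarith [neg_le_sum_range_add he ho hb m r]
  induction n with
  | zero => simp
  | succ n ih =>
    rw [Finset.sum_range_succ, norm_add_sq_real, ← real_inner_self_eq_norm_sq (v n), sum_inner]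
    have e1 : inner ℝ (v n) (v n) = d 0 := hv n 0
    have e2 : ∑ i ∈ Finset.range n, inner ℝ (v i) (v n)
        = ∑ k ∈ Finset.range n, d (k + 1) := by
      rw [← Finset.sum_range_reflect]
      refine Finset.sum_congr rfl fun k hk => ?_
      have hk := Finset.mem_range.1 hk
      rw [← hv (n - 1 - k) (k + 1)]
      congr 2
      omega
    have e3 := Finset.sum_range_succ' d n
    have := hs (n + 1) hn
    rw [e1, e2]
    push_cast
    linarith [ih (by omega)]

section SymmetricContraction

variable {H : Type*} [NormedAddCommGroup H] [InnerProductSpace ℝ H] {P : H →L[ℝ] H}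

theorem inner_pow_apply_comm (hsymm : ∀ a b, inner ℝ (P a) b = inner ℝ a (P b)) (j : ℕ) (a b : H) :
    inner ℝ ((P ^ j) a) b = inner ℝ a ((P ^ j) b) := by
  induction j generalizing a b with
  | zero => simp
  | succ j ih =>
    rw [pow_succ, mul_apply_eq_comp, ih, hsymm, ← mul_apply_eq_comp,
      ← pow_succ', pow_succ]

theorem norm_pow_apply_le (hP : ∀ a, ‖P a‖ ≤ ‖a‖) (j : ℕ) (a : H) : ‖(P ^ j) a‖ ≤ ‖a‖ := by
  induction j with
  | zero => simp
  | succ j ih =>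
    rw [pow_succ', mul_apply_eq_comp]
    exact (hP _).trans ih

theorem inner_pow_two_mul_self (hsymm : ∀ a b, inner ℝ (P a) b = inner ℝ a (P b)) (j : ℕ) (a : H) :
    inner ℝ a ((P ^ (2 * j)) a) = ‖(P ^ j) a‖ ^ 2 := by
  rw [two_mul, pow_add, mul_apply_eq_comp, ← inner_pow_apply_comm hsymm,
    real_inner_self_eq_norm_sq]

theorem inner_pow_pair_nonneg (hsymm : ∀ a b, inner ℝ (P a) b = inner ℝ a (P b))
    (hP : ∀ a, ‖P a‖ ≤ ‖a‖) (j : ℕ) (a : H) :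
    0 ≤ inner ℝ a ((P ^ (2 * j)) a) + inner ℝ a ((P ^ (2 * j + 1)) a) := by
  rw [inner_pow_two_mul_self hsymm, show 2 * j + 1 = j + (1 + j) by ring, pow_add,
    mul_apply_eq_comp, ← inner_pow_apply_comm hsymm, pow_add,
    mul_apply_eq_comp, pow_one]
  have h := abs_real_inner_le_norm ((P ^ j) a) (P ((P ^ j) a))
  have h2 := mul_le_mul_of_nonneg_left (hP ((P ^ j) a)) (norm_nonneg ((P ^ j) a))
  nlinarith [neg_le_of_abs_le h]

theorem abs_inner_pow_le (hP : ∀ a, ‖P a‖ ≤ ‖a‖) (k : ℕ) (a : H) :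
    |inner ℝ a ((P ^ k) a)| ≤ inner ℝ a ((P ^ 0) a) := by
  rw [pow_zero, one_apply_eq_self, real_inner_self_eq_norm_sq]
  have h := abs_real_inner_le_norm a ((P ^ k) a)
  have h2 := mul_le_mul_of_nonneg_left (norm_pow_apply_le hP k a) (norm_nonneg a)
  nlinarith

end SymmetricContraction

theorem norm_cexp_mul_I_sub_le (x : ℝ) :
    ‖Complex.exp (x * Complex.I) - (1 + x * Complex.I) * Complex.exp (-(x ^ 2) / 2 : ℝ)‖
      ≤ 2 * |x| ^ 3 * ‖(1 + x * Complex.I)‖ := by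
  have hge : 1 ≤ ‖(1 + x * Complex.I)‖ := by
    have := Complex.abs_re_le_norm (1 + x * Complex.I)
    simpa using this
  rcases le_total |x| 1 with hx | hx
  · have hxI : ‖(x * Complex.I : ℂ)‖ = |x| := by simp
    have h1 := Complex.exp_bound (x := x * Complex.I) (by rw [hxI]; exact hx) (n := 3) (by norm_num)
    rw [hxI] at h1
    have hx2 : x ^ 2 ≤ 1 := (sq_le_one_iff_abs_le_one x).2 hx
    have h2 := Real.abs_exp_sub_one_sub_id_le (x := -(x ^ 2) / 2) (by
      rw [abs_le]; constructor <;> nlinarith [sq_nonneg x])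
    set ρ : ℝ := Real.exp (-(x ^ 2) / 2) - 1 - (-(x ^ 2) / 2) with hρ
    set R : ℂ := Complex.exp (x * Complex.I)
      - ∑ m ∈ Finset.range 3, (x * Complex.I) ^ m / (m.factorial : ℂ) with hR
    have e : Complex.exp (x * Complex.I) - (1 + x * Complex.I) * Complex.exp (-(x ^ 2) / 2 : ℝ)
        = R + ((x ^ 3 / 2 : ℝ) : ℂ) * Complex.I - (1 + x * Complex.I) * (ρ : ℂ) := by
      have hρ' : Complex.exp (-(x ^ 2) / 2 : ℝ) = (ρ : ℂ) + 1 + (-(x ^ 2) / 2 : ℝ) := by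
        rw [← Complex.ofReal_exp, hρ]; push_cast; ring
      rw [hρ', hR]
      simp only [Finset.sum_range_succ, Finset.sum_range_zero, Nat.factorial]
      push_cast
      have := Complex.I_sq
      ring_nf
      simp only [Complex.I_sq]
      ring
    rw [e]
    have h3 : |x| ^ 4 ≤ |x| ^ 3 := pow_le_pow_of_le_one (abs_nonneg x) hx (by norm_num)
    have hR' : ‖R‖ ≤ |x| ^ 3 * (2 / 9) := by
      refine h1.trans (le_of_eq ?_)
      norm_num [Nat.factorial]
    have hρ2 : |ρ| ≤ |x| ^ 3 / 4 := by
      refine h2.trans ?_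
      have : (-(x ^ 2) / 2) ^ 2 = |x| ^ 4 / 4 := by
        have : |x| ^ 4 = (|x| ^ 2) ^ 2 := by ring
        rw [this, sq_abs]; ring
      rw [this]; linarith
    have hc : ‖((x ^ 3 / 2 : ℝ) : ℂ) * Complex.I‖ = |x| ^ 3 / 2 := by
      rw [norm_mul, Complex.norm_I, mul_one, Complex.norm_real, Real.norm_eq_abs, abs_div, abs_pow]
      norm_num
    calc _ ≤ ‖R‖ + ‖((x ^ 3 / 2 : ℝ) : ℂ) * Complex.I‖ + ‖(1 + x * Complex.I) * (ρ : ℂ)‖ :=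
          (norm_sub_le _ _).trans (add_le_add_left (norm_add_le _ _) _)
      _ ≤ |x| ^ 3 * (2 / 9) + |x| ^ 3 / 2 + ‖(1 + x * Complex.I)‖ * (|x| ^ 3 / 4) := by
          rw [hc, norm_mul, Complex.norm_real, Real.norm_eq_abs]
          gcongr
      _ ≤ _ := by nlinarith [pow_nonneg (abs_nonneg x) 3]
  · have h1 : ‖Complex.exp (x * Complex.I)‖ = 1 := Complex.norm_exp_ofReal_mul_I x
    have h2 : ‖Complex.exp (-(x ^ 2) / 2 : ℝ)‖ ≤ 1 := by
      rw [Complex.norm_exp_ofReal, Real.exp_le_one_iff]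
      nlinarith [sq_nonneg x]
    have h3 : 1 ≤ |x| ^ 3 := one_le_pow₀ hx
    calc _ ≤ ‖Complex.exp (x * Complex.I)‖ + ‖(1 + x * Complex.I) * Complex.exp (-(x ^ 2) / 2 : ℝ)‖ :=
          norm_sub_le _ _
      _ ≤ 1 + ‖(1 + x * Complex.I)‖ * 1 := by
          rw [h1, norm_mul]; gcongr
      _ ≤ _ := by nlinarith

theorem norm_sq_one_add_mul_I (x : ℝ) : ‖(1 + x * Complex.I)‖ ^ 2 = 1 + x ^ 2 := by
  rw [← Complex.normSq_eq_norm_sq, Complex.normSq_apply]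
  simp
  ring

theorem norm_prod_cexp_sub_le (x : ℕ → ℝ) (n : ℕ) :
    ‖∏ j ∈ Finset.range n, Complex.exp (x j * Complex.I)
        - (∏ j ∈ Finset.range n, (1 + x j * Complex.I))
          * Complex.exp (-(∑ j ∈ Finset.range n, x j ^ 2) / 2 : ℝ)‖
      ≤ (2 * ∑ j ∈ Finset.range n, |x j| ^ 3) * ‖∏ j ∈ Finset.range n, (1 + x j * Complex.I)‖ := by
  induction n with
  | zero => simp
  | succ n ih =>
    have hge : 1 ≤ ‖(1 + x n * Complex.I)‖ := by
      have := Complex.abs_re_le_norm (1 + x n * Complex.I)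
      simpa using this
    set A := ∏ j ∈ Finset.range n, Complex.exp (x j * Complex.I)
    set T := ∏ j ∈ Finset.range n, (1 + x j * Complex.I)
    set V := ∑ j ∈ Finset.range n, x j ^ 2
    rw [Finset.prod_range_succ, Finset.prod_range_succ, Finset.sum_range_succ,
      Finset.sum_range_succ]
    have e : Complex.exp (-(V + x n ^ 2) / 2 : ℝ)
        = Complex.exp (-V / 2 : ℝ) * Complex.exp (-(x n ^ 2) / 2 : ℝ) := by
      rw [← Complex.exp_add]; congr 1; push_cast; ring
    have hV : ‖Complex.exp (-V / 2 : ℝ)‖ ≤ 1 := by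
      have : 0 ≤ V := Finset.sum_nonneg fun j _ => sq_nonneg _
      rw [Complex.norm_exp_ofReal, Real.exp_le_one_iff]
      linarith
    have e2 : A * Complex.exp (x n * Complex.I)
          - T * (1 + x n * Complex.I) * Complex.exp (-(V + x n ^ 2) / 2 : ℝ)
        = (A - T * Complex.exp (-V / 2 : ℝ)) * Complex.exp (x n * Complex.I)
          + T * Complex.exp (-V / 2 : ℝ) * (Complex.exp (x n * Complex.I)
            - (1 + x n * Complex.I) * Complex.exp (-(x n ^ 2) / 2 : ℝ)) := by
      rw [e]; ring
    rw [e2]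
    refine (norm_add_le _ _).trans ?_
    rw [norm_mul, norm_mul, norm_mul, norm_mul, Complex.norm_exp_ofReal_mul_I, mul_one]
    have h1 := norm_cexp_mul_I_sub_le (x n)
    have hS : 0 ≤ ∑ j ∈ Finset.range n, |x j| ^ 3 := Finset.sum_nonneg fun j _ => by positivity
    calc _ ≤ (2 * ∑ j ∈ Finset.range n, |x j| ^ 3) * ‖T‖ * 1
          + ‖T‖ * 1 * (2 * |x n| ^ 3 * ‖(1 + x n * Complex.I)‖) := by
          rw [mul_one]; gcongr
      _ ≤ (2 * ∑ j ∈ Finset.range n, |x j| ^ 3) * ‖T‖ * ‖(1 + x n * Complex.I)‖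
          + ‖T‖ * 1 * (2 * |x n| ^ 3 * ‖(1 + x n * Complex.I)‖) := by gcongr
      _ = _ := by ring

theorem abs_exp_neg_sub_exp_neg_le {a b : ℝ} (ha : 0 ≤ a) (hb : 0 ≤ b) :
    |Real.exp (-a) - Real.exp (-b)| ≤ |a - b| := by
  wlog h : a ≤ b generalizing a b
  · rw [abs_sub_comm, abs_sub_comm a]
    exact this hb ha (le_of_not_ge h)
  have h1 : Real.exp (-b) ≤ Real.exp (-a) := Real.exp_le_exp.2 (by linarith)
  rw [abs_of_nonneg (by linarith), abs_of_nonpos (by linarith)]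
  have h2 : Real.exp (-b) = Real.exp (-a) * Real.exp (-(b - a)) := by
    rw [← Real.exp_add]; congr 1; ring
  have h3 := Real.add_one_le_exp (-(b - a))
  have h4 : Real.exp (-a) ≤ 1 := Real.exp_le_one_iff.2 (by linarith)
  nlinarith [Real.exp_pos (-a)]

section Martingale

variable {Ω : Type*} {mΩ : MeasurableSpace Ω}

/-- The increment `ξ k`, switched off once the sum of the squares of the earlier increments
exceeds `C`. -/
def stoppedIncrement (ξ : ℕ → Ω → ℝ) (C : ℝ) (k : ℕ) (ω : Ω) : ℝ :=
  if ∑ j ∈ Finset.range k, ξ j ω ^ 2 ≤ C then ξ k ω else 0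

/-- McLeish's product `∏ (1 + i t ζ_j)` over the stopped increments `ζ_j`. -/
def stoppedProd (ξ : ℕ → Ω → ℝ) (C t : ℝ) (k : ℕ) (ω : Ω) : ℂ :=
  ∏ j ∈ Finset.range k, (1 + (t * stoppedIncrement ξ C j ω : ℝ) * Complex.I)

/-- The product `stoppedProd`, set to zero once the sum of the squares of the increments
exceeds `C`. -/
def stoppedWeight (ξ : ℕ → Ω → ℝ) (C t : ℝ) (k : ℕ) (ω : Ω) : ℂ :=
  if ∑ j ∈ Finset.range k, ξ j ω ^ 2 ≤ C then stoppedProd ξ C t k ω else 0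

variable {ξ : ℕ → Ω → ℝ} {C t : ℝ}

theorem stoppedIncrement_eq {k : ℕ} {ω : Ω} (h : ∑ j ∈ Finset.range (k + 1), ξ j ω ^ 2 ≤ C)
    {j : ℕ} (hj : j ≤ k) : stoppedIncrement ξ C j ω = ξ j ω :=
  if_pos ((Finset.sum_le_sum_of_subset_of_nonneg (Finset.range_mono (by omega))
    fun i _ _ => sq_nonneg _).trans h)

theorem stoppedProd_eq {k : ℕ} {ω : Ω} (h : ∑ j ∈ Finset.range k, ξ j ω ^ 2 ≤ C) :
    stoppedProd ξ C t k ω = ∏ j ∈ Finset.range k, (1 + (t * ξ j ω : ℝ) * Complex.I) := by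
  refine Finset.prod_congr rfl fun j hj => ?_
  have hj := Finset.mem_range.1 hj
  obtain ⟨k, rfl⟩ : ∃ m, k = m + 1 := ⟨k - 1, by omega⟩
  rw [stoppedIncrement_eq h (by omega)]

theorem stoppedProd_succ (k : ℕ) (ω : Ω) :
    stoppedProd ξ C t (k + 1) ω
      = stoppedProd ξ C t k ω + t * Complex.I * (ξ k ω • stoppedWeight ξ C t k ω) := by
  rw [stoppedProd, Finset.prod_range_succ, ← stoppedProd, stoppedIncrement, stoppedWeight]
  split_ifs
  · rw [Complex.real_smul]; push_cast; ring
  · simp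

theorem norm_sq_stoppedProd_succ (k : ℕ) (ω : Ω) :
    ‖stoppedProd ξ C t (k + 1) ω‖ ^ 2
      = ‖stoppedProd ξ C t k ω‖ ^ 2 + t ^ 2 * (ξ k ω ^ 2 * ‖stoppedWeight ξ C t k ω‖ ^ 2) := by
  rw [stoppedProd, Finset.prod_range_succ, ← stoppedProd, norm_mul, mul_pow,
    norm_sq_one_add_mul_I, stoppedIncrement, stoppedWeight]
  split_ifs
  · ring
  · simp

theorem one_le_norm_stoppedProd (k : ℕ) (ω : Ω) : 1 ≤ ‖stoppedProd ξ C t k ω‖ := by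
  rw [← one_le_sq_iff₀ (norm_nonneg _)]
  induction k with
  | zero => simp [stoppedProd]
  | succ k ih =>
    rw [norm_sq_stoppedProd_succ]
    exact le_add_of_le_of_nonneg ih (by positivity)

theorem norm_sq_stoppedWeight_le (k : ℕ) (ω : Ω) :
    ‖stoppedWeight ξ C t k ω‖ ^ 2 ≤ Real.exp (t ^ 2 * C) := by
  rw [stoppedWeight]
  split_ifs with h
  · rw [stoppedProd_eq h, norm_prod, ← Finset.prod_pow]
    simp_rw [norm_sq_one_add_mul_I]
    calc _ ≤ ∏ j ∈ Finset.range k, Real.exp ((t * ξ j ω) ^ 2) :=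
          Finset.prod_le_prod (fun j _ => by positivity)
            fun j _ => by linarith [Real.add_one_le_exp ((t * ξ j ω) ^ 2)]
      _ = Real.exp (t ^ 2 * ∑ j ∈ Finset.range k, ξ j ω ^ 2) := by
          rw [← Real.exp_sum, Finset.mul_sum]; simp_rw [mul_pow]
      _ ≤ _ := by gcongr
  · simpa using (Real.exp_pos _).le

variable {μ : Measure Ω} [IsProbabilityMeasure μ] {F : ℕ → MeasurableSpace Ω}

theorem measurable_stoppedWeight (hmono : Monotone F) (hξ : ∀ k, Measurable[F (k + 1)] (ξ k))
    (k : ℕ) : Measurable[F k] (stoppedWeight ξ C t k) := by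
  have hξ' : ∀ j k, j < k → Measurable[F k] (ξ j) := fun j k h =>
    (hξ j).mono (hmono h) le_rfl
  have hV : ∀ j, j ≤ k → MeasurableSet[F k] {ω | ∑ i ∈ Finset.range j, ξ i ω ^ 2 ≤ C} := by
    intro j hj
    refine (?_ : Measurable[F k] fun ω => ∑ i ∈ Finset.range j, ξ i ω ^ 2) (measurableSet_Iic (a := C))
    exact @Finset.measurable_fun_sum _ _ _ _ _ _ (F k) _ _ fun i hi =>
      (hξ' i k (by have := Finset.mem_range.1 hi; omega)).pow_const 2
  refine Measurable.ite (hV k le_rfl) ?_ measurable_const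
  refine @Finset.measurable_fun_prod _ _ _ _ _ _ (F k) _ _ fun j hj => ?_
  have hj := Finset.mem_range.1 hj
  refine Measurable.const_add (Measurable.mul_const (Complex.measurable_ofReal.comp ?_) _) _
  exact (Measurable.ite (hV j hj.le) (hξ' j k hj) measurable_const).const_mul t

theorem stoppedProd_integral (hF : ∀ k, F k ≤ mΩ) (hmono : Monotone F)
    (hξ : ∀ k, Measurable[F (k + 1)] (ξ k)) (hint : ∀ k, MemLp (ξ k) 2 μ)
    (hmart : ∀ k, μ[ξ k | F k] =ᵐ[μ] 0) (k : ℕ) :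
    Integrable (stoppedProd ξ C t k) μ ∧ ∫ ω, stoppedProd ξ C t k ω ∂μ = 1 := by
  induction k with
  | zero =>
    have e : stoppedProd ξ C t 0 = fun _ => 1 := by ext ω; simp [stoppedProd]
    simp [e]
  | succ k ih =>
    have hW : Measurable[F k] (stoppedWeight ξ C t k) := measurable_stoppedWeight hmono hξ k
    have hWb : ∀ ω, ‖stoppedWeight ξ C t k ω‖ ≤ Real.sqrt (Real.exp (t ^ 2 * C)) := fun ω =>
      Real.le_sqrt_of_sq_le (norm_sq_stoppedWeight_le k ω)
    have hi : Integrable (ξ k) μ := (hint k).integrable (by norm_num)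
    have hWi : Integrable (ξ k • stoppedWeight ξ C t k) μ :=
      hi.smul_bdd _ (hW.mono (hF k) le_rfl).aestronglyMeasurable (ae_of_all _ hWb)
    have h0 : ∫ ω, (ξ k • stoppedWeight ξ C t k) ω ∂μ = 0 := by
      rw [← integral_condExp (hF k)]
      have h := condExp_smul_of_aestronglyMeasurable_right hi hWi
        (hW.stronglyMeasurable.aestronglyMeasurable (m := F k) (μ := μ))
      rw [integral_congr_ae h]
      refine (integral_congr_ae (g := fun _ => 0) ?_).trans (by simp)
      filter_upwards [hmart k] with ω hω
      simp [hω]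
    have e : stoppedProd ξ C t (k + 1) = fun ω => stoppedProd ξ C t k ω
        + t * Complex.I * (ξ k • stoppedWeight ξ C t k) ω := by
      ext ω; exact stoppedProd_succ k ω
    rw [e]
    refine ⟨ih.1.add (hWi.const_mul _), ?_⟩
    rw [integral_add ih.1 (hWi.const_mul _), integral_const_mul, h0, ih.2]
    simp

theorem integral_norm_sq_stoppedProd_le (hF : ∀ k, F k ≤ mΩ) (hmono : Monotone F)
    (hξ : ∀ k, Measurable[F (k + 1)] (ξ k)) (hint : ∀ k, MemLp (ξ k) 2 μ) (k : ℕ) :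
    Integrable (fun ω => ‖stoppedProd ξ C t k ω‖ ^ 2) μ ∧
      ∫ ω, ‖stoppedProd ξ C t k ω‖ ^ 2 ∂μ
        ≤ 1 + t ^ 2 * Real.exp (t ^ 2 * C) * ∫ ω, ∑ j ∈ Finset.range k, ξ j ω ^ 2 ∂μ := by
  induction k with
  | zero => simp [stoppedProd]
  | succ k ih =>
    have hW := (measurable_stoppedWeight (C := C) (t := t) hmono hξ k).mono (hF k) le_rfl
    have hi : Integrable (fun ω => ξ k ω ^ 2) μ := (hint k).integrable_sq
    have hWi : Integrable (fun ω => ξ k ω ^ 2 * ‖stoppedWeight ξ C t k ω‖ ^ 2) μ :=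
      hi.mul_bdd (c := Real.exp (t ^ 2 * C)) (hW.norm.pow_const 2).aestronglyMeasurable
        (ae_of_all _ fun ω => by
          rw [Real.norm_of_nonneg (sq_nonneg _)]; exact norm_sq_stoppedWeight_le k ω)
    simp_rw [norm_sq_stoppedProd_succ, Finset.sum_range_succ]
    refine ⟨ih.1.add (hWi.const_mul _), ?_⟩
    rw [integral_add ih.1 (hWi.const_mul _), integral_const_mul,
      integral_add (integrable_finsetSum _ fun j _ => (hint j).integrable_sq) hi]
    have h1 : ∫ ω, ξ k ω ^ 2 * ‖stoppedWeight ξ C t k ω‖ ^ 2 ∂μ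
        ≤ (∫ ω, ξ k ω ^ 2 ∂μ) * Real.exp (t ^ 2 * C) := by
      rw [← integral_mul_const]
      exact integral_mono hWi (hi.mul_const _) fun ω =>
        mul_le_mul_of_nonneg_left (norm_sq_stoppedWeight_le k ω) (sq_nonneg _)
    have := mul_le_mul_of_nonneg_left h1 (sq_nonneg t)
    nlinarith [ih.2]

theorem norm_cexp_sub_stoppedProd_mul_le {s : ℝ} (hs : 0 ≤ s) (n : ℕ) (ω : Ω) :
    ‖Complex.exp ((t * ∑ j ∈ Finset.range n, ξ j ω : ℝ) * Complex.I)
        - stoppedProd ξ (s + 1) t n ω * Complex.exp (-(t ^ 2 * s / 2) : ℝ)‖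
      ≤ ‖stoppedProd ξ (s + 1) t n ω‖ *
        min 2 (2 * |t| ^ 3 * ∑ j ∈ Finset.range n, |ξ j ω| ^ 3
          + (t ^ 2 / 2 + 2) * |∑ j ∈ Finset.range n, ξ j ω ^ 2 - s|) := by
  set V := ∑ j ∈ Finset.range n, ξ j ω ^ 2 with hV
  set T := stoppedProd ξ (s + 1) t n ω with hT
  have hT1 : 1 ≤ ‖T‖ := one_le_norm_stoppedProd n ω
  have hc : ‖Complex.exp (-(t ^ 2 * s / 2) : ℝ)‖ ≤ 1 := by
    rw [Complex.norm_exp_ofReal, Real.exp_le_one_iff]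
    have := mul_nonneg (sq_nonneg t) hs
    linarith
  have hS : 0 ≤ 2 * |t| ^ 3 * ∑ j ∈ Finset.range n, |ξ j ω| ^ 3 :=
    mul_nonneg (by positivity) (Finset.sum_nonneg fun j _ => by positivity)
  have h2 : ‖Complex.exp ((t * ∑ j ∈ Finset.range n, ξ j ω : ℝ) * Complex.I)
      - T * Complex.exp (-(t ^ 2 * s / 2) : ℝ)‖ ≤ ‖T‖ * 2 := by
    refine (norm_sub_le _ _).trans ?_
    rw [Complex.norm_exp_ofReal_mul_I, norm_mul]
    nlinarith
  rw [mul_min_of_nonneg _ _ (norm_nonneg _)]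
  refine le_min h2 ?_
  by_cases h : V ≤ s + 1
  · have hTe : T = ∏ j ∈ Finset.range n, (1 + (t * ξ j ω : ℝ) * Complex.I) := stoppedProd_eq h
    have h3 := norm_prod_cexp_sub_le (fun j => t * ξ j ω) n
    rw [← hTe, ← Complex.exp_sum] at h3
    have e1 : ∑ j ∈ Finset.range n, ((t * ξ j ω : ℝ) : ℂ) * Complex.I
        = (t * ∑ j ∈ Finset.range n, ξ j ω : ℝ) * Complex.I := by
      rw [Finset.mul_sum, Complex.ofReal_sum, Finset.sum_mul]
    have e2 : ∑ j ∈ Finset.range n, (t * ξ j ω) ^ 2 = t ^ 2 * V := by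
      rw [hV, Finset.mul_sum]; simp_rw [mul_pow]
    have e3 : ∑ j ∈ Finset.range n, |t * ξ j ω| ^ 3
        = |t| ^ 3 * ∑ j ∈ Finset.range n, |ξ j ω| ^ 3 := by
      rw [Finset.mul_sum]; simp_rw [abs_mul, mul_pow]
    rw [e1, e2, e3] at h3
    have hV0 : 0 ≤ V := Finset.sum_nonneg fun j _ => sq_nonneg _
    have h4 : ‖Complex.exp (-(t ^ 2 * V) / 2 : ℝ) - Complex.exp (-(t ^ 2 * s / 2) : ℝ)‖
        ≤ t ^ 2 / 2 * |V - s| := by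
      rw [← Complex.ofReal_exp, ← Complex.ofReal_exp, ← Complex.ofReal_sub, Complex.norm_real,
        Real.norm_eq_abs, neg_div]
      refine (abs_exp_neg_sub_exp_neg_le (by positivity) (by positivity)).trans (le_of_eq ?_)
      rw [show t ^ 2 * V / 2 - t ^ 2 * s / 2 = t ^ 2 / 2 * (V - s) by ring, abs_mul,
        abs_of_nonneg (by positivity)]
    have e4 : Complex.exp ((t * ∑ j ∈ Finset.range n, ξ j ω : ℝ) * Complex.I)
        - T * Complex.exp (-(t ^ 2 * s / 2) : ℝ)
        = (Complex.exp ((t * ∑ j ∈ Finset.range n, ξ j ω : ℝ) * Complex.I)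
          - T * Complex.exp (-(t ^ 2 * V) / 2 : ℝ))
          + T * (Complex.exp (-(t ^ 2 * V) / 2 : ℝ) - Complex.exp (-(t ^ 2 * s / 2) : ℝ)) := by
      ring
    rw [e4]
    refine (norm_add_le _ _).trans ?_
    rw [norm_mul]
    have h5 := mul_le_mul_of_nonneg_left h4 (norm_nonneg T)
    have h6 : 0 ≤ ‖T‖ * |V - s| := by positivity
    nlinarith
  · have h5 : 1 ≤ |V - s| := le_trans (by linarith) (le_abs_self _)
    refine h2.trans (mul_le_mul_of_nonneg_left ?_ (norm_nonneg _))
    nlinarith [mul_nonneg (sq_nonneg t) (abs_nonneg (V - s))]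

/-- A quantitative form of McLeish's martingale central limit theorem. -/
theorem norm_integral_cexp_sub_le (hF : ∀ k, F k ≤ mΩ) (hmono : Monotone F)
    (hξ : ∀ k, Measurable[F (k + 1)] (ξ k)) (hint : ∀ k, MemLp (ξ k) 2 μ)
    (hint3 : ∀ k, Integrable (fun ω => |ξ k ω| ^ 3) μ)
    (hmart : ∀ k, μ[ξ k | F k] =ᵐ[μ] 0) {s ε : ℝ} (hs : 0 ≤ s) (hε : 0 < ε) (t : ℝ) (n : ℕ) :
    ‖∫ ω, Complex.exp ((t * ∑ j ∈ Finset.range n, ξ j ω : ℝ) * Complex.I) ∂μ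
        - Complex.exp (-(t ^ 2 * s / 2) : ℝ)‖
      ≤ ε * (1 + t ^ 2 * Real.exp (t ^ 2 * (s + 1))
          * (s + ∫ ω, |∑ j ∈ Finset.range n, ξ j ω ^ 2 - s| ∂μ))
        + (2 * |t| ^ 3 * ∑ j ∈ Finset.range n, ∫ ω, |ξ j ω| ^ 3 ∂μ
          + (t ^ 2 / 2 + 2) * ∫ ω, |∑ j ∈ Finset.range n, ξ j ω ^ 2 - s| ∂μ) / (2 * ε) := by
  have hξm : ∀ k, Measurable (ξ k) := fun k => (hξ k).mono (hF _) le_rfl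
  obtain ⟨hTi, hT1⟩ := stoppedProd_integral (C := s + 1) (t := t) hF hmono hξ hint hmart n
  obtain ⟨hT2i, hT2⟩ := integral_norm_sq_stoppedProd_le (C := s + 1) (t := t) hF hmono hξ hint n
  have hVi : Integrable (fun ω => ∑ j ∈ Finset.range n, ξ j ω ^ 2) μ :=
    integrable_finsetSum _ fun j _ => (hint j).integrable_sq
  have hAi : Integrable (fun ω => |∑ j ∈ Finset.range n, ξ j ω ^ 2 - s|) μ :=
    (hVi.sub (integrable_const s)).abs
  have hLi : Integrable (fun ω => ∑ j ∈ Finset.range n, |ξ j ω| ^ 3) μ :=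
    integrable_finsetSum _ fun j _ => hint3 j
  have hEi : Integrable (fun ω =>
      Complex.exp ((t * ∑ j ∈ Finset.range n, ξ j ω : ℝ) * Complex.I)) μ := by
    refine Integrable.of_bound (C := 1) ?_ (ae_of_all _ fun ω => by
      rw [Complex.norm_exp_ofReal_mul_I])
    have : Measurable (fun ω => t * ∑ j ∈ Finset.range n, ξ j ω) :=
      (Finset.measurable_fun_sum _ fun j _ => hξm j).const_mul t
    fun_prop
  have hVle : ∫ ω, ∑ j ∈ Finset.range n, ξ j ω ^ 2 ∂μ
      ≤ s + ∫ ω, |∑ j ∈ Finset.range n, ξ j ω ^ 2 - s| ∂μ := by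
    have := integral_mono hVi ((integrable_const s).add hAi) fun ω => by
      have := le_abs_self (∑ j ∈ Finset.range n, ξ j ω ^ 2 - s)
      simp only [Pi.add_apply]
      linarith
    rw [integral_add' (integrable_const s) hAi] at this
    simpa using this
  have e1 : ∫ ω, Complex.exp ((t * ∑ j ∈ Finset.range n, ξ j ω : ℝ) * Complex.I) ∂μ
        - Complex.exp (-(t ^ 2 * s / 2) : ℝ)
      = ∫ ω, (Complex.exp ((t * ∑ j ∈ Finset.range n, ξ j ω : ℝ) * Complex.I)
        - stoppedProd ξ (s + 1) t n ω * Complex.exp (-(t ^ 2 * s / 2) : ℝ)) ∂μ := by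
    rw [integral_sub hEi (hTi.mul_const _), integral_mul_const, hT1, one_mul]
  rw [e1]
  have hbound : ∀ ω, ‖Complex.exp ((t * ∑ j ∈ Finset.range n, ξ j ω : ℝ) * Complex.I)
        - stoppedProd ξ (s + 1) t n ω * Complex.exp (-(t ^ 2 * s / 2) : ℝ)‖
      ≤ ε * ‖stoppedProd ξ (s + 1) t n ω‖ ^ 2
        + (2 * |t| ^ 3 * ∑ j ∈ Finset.range n, |ξ j ω| ^ 3
          + (t ^ 2 / 2 + 2) * |∑ j ∈ Finset.range n, ξ j ω ^ 2 - s|) / (2 * ε) := by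
    intro ω
    refine (norm_cexp_sub_stoppedProd_mul_le hs n ω).trans ?_
    set a := ‖stoppedProd ξ (s + 1) t n ω‖
    set δ := 2 * |t| ^ 3 * ∑ j ∈ Finset.range n, |ξ j ω| ^ 3
          + (t ^ 2 / 2 + 2) * |∑ j ∈ Finset.range n, ξ j ω ^ 2 - s|
    have hδ : 0 ≤ δ := add_nonneg
      (mul_nonneg (by positivity) (Finset.sum_nonneg fun j _ => by positivity)) (by positivity)
    have hm0 : 0 ≤ min 2 δ := le_min (by norm_num) hδ
    have hm2 : min 2 δ ^ 2 ≤ 2 * δ := by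
      nlinarith [min_le_left 2 δ, min_le_right 2 δ]
    have h1 : a * min 2 δ ≤ ε * a ^ 2 + min 2 δ ^ 2 / (4 * ε) := by
      have : ε * a ^ 2 + min 2 δ ^ 2 / (4 * ε) - a * min 2 δ
          = (2 * ε * a - min 2 δ) ^ 2 / (4 * ε) := by field_simp; ring
      have : 0 ≤ (2 * ε * a - min 2 δ) ^ 2 / (4 * ε) := by positivity
      linarith
    have h2 : min 2 δ ^ 2 / (4 * ε) ≤ δ / (2 * ε) := by
      rw [div_le_div_iff₀ (by positivity) (by positivity)]
      nlinarith
    linarith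
  have hδi : Integrable (fun ω => (2 * |t| ^ 3 * ∑ j ∈ Finset.range n, |ξ j ω| ^ 3
      + (t ^ 2 / 2 + 2) * |∑ j ∈ Finset.range n, ξ j ω ^ 2 - s|) / (2 * ε)) μ :=
    ((hLi.const_mul _).add (hAi.const_mul _)).div_const _
  refine (norm_integral_le_of_norm_le ((hT2i.const_mul ε).add hδi) (ae_of_all _ hbound)).trans ?_
  simp only [Pi.add_apply]
  rw [integral_add (hT2i.const_mul ε) hδi, integral_div, integral_const_mul,
    integral_add (hLi.const_mul _) (hAi.const_mul _), integral_const_mul, integral_const_mul,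
    integral_finsetSum _ fun j _ => hint3 j]
  gcongr
  exact hT2.trans (by gcongr)

end Martingale

section Chain

variable {Ω : Type*} [MeasurableSpace Ω] {μ : Measure Ω} {X : ℤ → Ω → ℝ}

theorem monotone_pastSigma (X : ℤ → Ω → ℝ) : Monotone (pastSigma X) := fun _ _ h =>
  iSup₂_le fun j hj => le_iSup₂_of_le j (hj.trans h) le_rfl

theorem comap_le_pastSigma (X : ℤ → Ω → ℝ) (k : ℤ) :
    MeasurableSpace.comap (X k) inferInstance ≤ pastSigma X k :=
  le_iSup₂_of_le (f := fun (j : ℤ) (_ : j ≤ k) =>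
    MeasurableSpace.comap (X j) (inferInstance : MeasurableSpace ℝ)) k le_rfl le_rfl

theorem measurable_pastSigma (X : ℤ → Ω → ℝ) {j k : ℤ} (h : j ≤ k) :
    Measurable[pastSigma X k] (X j) :=
  (comap_measurable (X j)).mono ((comap_le_pastSigma X j).trans (monotone_pastSigma X h)) le_rfl

theorem integral_sq_eq_norm_sq {Y : Ω → ℝ} {Z : Lp ℝ 2 μ} (h : Z =ᵐ[μ] Y) :
    ∫ ω, Y ω ^ 2 ∂μ = ‖Z‖ ^ 2 := by
  rw [← real_inner_self_eq_norm_sq, L2.inner_def]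
  refine integral_congr_ae ?_
  filter_upwards [h] with ω h1
  rw [h1, real_inner_self_eq_norm_sq, Real.norm_eq_abs, sq_abs]

namespace IsStationaryReversibleMarkov

theorem pastSigma_le (hX : IsStationaryReversibleMarkov μ X) (k : ℤ) :
    pastSigma X k ≤ ‹MeasurableSpace Ω› :=
  iSup₂_le fun j _ => (hX.meas j).comap_le

theorem measurePreserving (hX : IsStationaryReversibleMarkov μ X) (k : ℤ) :
    MeasurePreserving (X k) μ (μ.map (X 0)) := by
  refine ⟨hX.meas k, ?_⟩
  have h := congrArg (Measure.map fun x : ℤ → ℝ => x 0) (hX.stationary k)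
  rw [Measure.map_map (measurable_pi_apply 0) (measurable_pi_lambda _ fun j => hX.meas _),
    Measure.map_map (measurable_pi_apply 0) (measurable_pi_lambda _ fun j => hX.meas _)] at h
  simpa [Function.comp_def] using h

theorem map_pair (hX : IsStationaryReversibleMarkov μ X) (k : ℤ) :
    μ.map (fun ω => (X k ω, X (k + 1) ω)) = μ.map (fun ω => (X 0 ω, X 1 ω)) := by
  have hm : Measurable fun x : ℤ → ℝ => (x 0, x 1) := by fun_prop
  have h := congrArg (Measure.map fun x : ℤ → ℝ => (x 0, x 1)) (hX.stationary k)
  rw [Measure.map_map hm (measurable_pi_lambda _ fun j => hX.meas _),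
    Measure.map_map hm (measurable_pi_lambda _ fun j => hX.meas _)] at h
  simpa [Function.comp_def, add_comm] using h

/-- The isometry `f ↦ f ∘ X k` from `L²` of the marginal law to `L²(μ)`. -/
def compLp (hX : IsStationaryReversibleMarkov μ X) (k : ℤ) :
    Lp ℝ 2 (μ.map (X 0)) →ₗᵢ[ℝ] Lp ℝ 2 μ :=
  Lp.compMeasurePreservingₗᵢ ℝ (X k) (hX.measurePreserving k)

theorem coeFn_compLp (hX : IsStationaryReversibleMarkov μ X) (k : ℤ)
    (f : Lp ℝ 2 (μ.map (X 0))) : hX.compLp k f =ᵐ[μ] fun ω => f (X k ω) :=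
  Lp.coeFn_compMeasurePreserving f (hX.measurePreserving k)

theorem compLp_toLp (hX : IsStationaryReversibleMarkov μ X) (k : ℤ) {f : ℝ → ℝ}
    (hf : MemLp f 2 (μ.map (X 0))) : hX.compLp k (hf.toLp f) =ᵐ[μ] fun ω => f (X k ω) :=
  (hX.coeFn_compLp k _).trans ((hX.measurePreserving k).quasiMeasurePreserving.ae_eq hf.coeFn_toLp)

/-- The transition operator of the chain on `L²` of the marginal law. -/
def transition (hX : IsStationaryReversibleMarkov μ X) :
    Lp ℝ 2 (μ.map (X 0)) →L[ℝ] Lp ℝ 2 (μ.map (X 0)) :=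
  ContinuousLinearMap.adjoint (hX.compLp 0).toContinuousLinearMap
    ∘L (hX.compLp 1).toContinuousLinearMap

theorem inner_compLp (hX : IsStationaryReversibleMarkov μ X) (k l : ℤ)
    (a b : Lp ℝ 2 (μ.map (X 0))) :
    inner ℝ (hX.compLp k a) (hX.compLp l b) = ∫ ω, a (X k ω) * b (X l ω) ∂μ := by
  rw [L2.inner_def]
  refine integral_congr_ae ?_
  filter_upwards [hX.coeFn_compLp k a, hX.coeFn_compLp l b] with ω h1 h2
  rw [h1, h2, real_inner_eq_re_inner, RCLike.inner_apply]
  simp [mul_comm]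

theorem inner_compLp_eq_integral_map (hX : IsStationaryReversibleMarkov μ X) (k l : ℤ)
    (a b : Lp ℝ 2 (μ.map (X 0))) :
    inner ℝ (hX.compLp k a) (hX.compLp l b)
      = ∫ p, a p.1 * b p.2 ∂(μ.map fun ω => (X k ω, X l ω)) := by
  rw [inner_compLp, integral_map ((hX.meas k).prodMk (hX.meas l)).aemeasurable]
  exact (((Lp.stronglyMeasurable a).comp_measurable measurable_fst).mul
    ((Lp.stronglyMeasurable b).comp_measurable measurable_snd)).aestronglyMeasurable

theorem inner_transition (hX : IsStationaryReversibleMarkov μ X) (k : ℤ)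
    (a b : Lp ℝ 2 (μ.map (X 0))) :
    inner ℝ a (hX.transition b) = inner ℝ (hX.compLp k a) (hX.compLp (k + 1) b) := by
  rw [inner_compLp_eq_integral_map, hX.map_pair k, ← hX.inner_compLp_eq_integral_map, transition,
    ContinuousLinearMap.comp_apply, ContinuousLinearMap.adjoint_inner_right]
  rfl

theorem transition_symm (hX : IsStationaryReversibleMarkov μ X) (a b : Lp ℝ 2 (μ.map (X 0))) :
    inner ℝ (hX.transition a) b = inner ℝ a (hX.transition b) := by
  rw [real_inner_comm, hX.inner_transition 0, hX.inner_transition 0, zero_add,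
    inner_compLp_eq_integral_map, hX.reversible, ← hX.inner_compLp_eq_integral_map, real_inner_comm]

theorem norm_transition_le (hX : IsStationaryReversibleMarkov μ X) (a : Lp ℝ 2 (μ.map (X 0))) :
    ‖hX.transition a‖ ≤ ‖a‖ := by
  have h := real_inner_le_norm (hX.compLp 0 (hX.transition a)) (hX.compLp (0 + 1) a)
  rw [← hX.inner_transition, real_inner_self_eq_norm_sq, LinearIsometry.norm_map,
    LinearIsometry.norm_map] at h
  by_contra! hlt
  nlinarith [norm_nonneg a]

theorem aestronglyMeasurable_compLp (hX : IsStationaryReversibleMarkov μ X) {j k : ℤ} (h : j ≤ k)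
    (a : Lp ℝ 2 (μ.map (X 0))) : AEStronglyMeasurable[pastSigma X k] (hX.compLp j a) μ :=
  AEStronglyMeasurable.congr ((Lp.stronglyMeasurable a).comp_measurable
    (measurable_pastSigma X h)).aestronglyMeasurable (hX.coeFn_compLp j a).symm

theorem sum_inner_pow_nonneg (hX : IsStationaryReversibleMarkov μ X)
    (h : Lp ℝ 2 (μ.map (X 0))) (m j : ℕ) :
    0 ≤ ∑ k ∈ Finset.range m, inner ℝ h ((hX.transition ^ (2 * j + k)) h) :=
  sum_range_two_mul_add_nonneg (d := fun k => inner ℝ h ((hX.transition ^ k) h))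
    (fun j => by rw [inner_pow_two_mul_self hX.transition_symm]; positivity)
    (fun j => inner_pow_pair_nonneg hX.transition_symm hX.norm_transition_le j h) m j

theorem memLp_comp (hX : IsStationaryReversibleMarkov μ X) {p : ENNReal} {f : ℝ → ℝ}
    (hf : MemLp f p (μ.map (X 0))) (k : ℤ) : MemLp (fun ω => f (X k ω)) p μ :=
  hf.comp_measurePreserving (hX.measurePreserving k)

theorem integral_comp (hX : IsStationaryReversibleMarkov μ X) {f : ℝ → ℝ} (hf : Measurable f)
    (k : ℤ) : ∫ ω, f (X k ω) ∂μ = ∫ ω, f (X 0 ω) ∂μ := by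
  rw [← integral_map (hX.meas k).aemeasurable hf.aestronglyMeasurable,
    (hX.measurePreserving k).map_eq,
    integral_map (hX.meas 0).aemeasurable hf.aestronglyMeasurable]

variable [IsProbabilityMeasure μ]

theorem isProbabilityMeasure_map (hX : IsStationaryReversibleMarkov μ X) :
    IsProbabilityMeasure (μ.map (X 0)) :=
  Measure.isProbabilityMeasure_map (hX.meas 0).aemeasurable

theorem inner_compLp_succ_indicator (hX : IsStationaryReversibleMarkov μ X) (k : ℤ)
    {H : Lp ℝ 2 μ} (hH : AEStronglyMeasurable[pastSigma X k] H μ) {A : Set ℝ}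
    (hA : MeasurableSet A) (hμA : μ.map (X 0) A ≠ ⊤) :
    inner ℝ H (hX.compLp (k + 1) (indicatorConstLp 2 hA hμA 1))
      = inner ℝ H (hX.compLp k (hX.transition (indicatorConstLp 2 hA hμA 1))) := by
  set g : ℝ → ℝ := A.indicator fun _ => 1 with hg
  have hgm : Measurable g := measurable_const.indicator hA
  have hgb : ∀ x, |g x| ≤ 1 := fun x => by
    rw [hg]; by_cases h : x ∈ A <;> simp [h]
  set Y : Ω → ℝ := fun ω => g (X (k + 1) ω) with hY
  have hYi : Integrable Y μ := Integrable.of_bound (C := 1)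
    (hgm.comp (hX.meas _)).aestronglyMeasurable (ae_of_all _ fun ω => hgb _)
  set q : Ω → ℝ := μ[Y | MeasurableSpace.comap (X k) inferInstance] with hq
  have hqb : ∀ᵐ ω ∂μ, ‖q ω‖ ≤ 1 :=
    ae_bdd_abs_condExp_of_ae_bdd_abs (R := 1) (ae_of_all _ fun ω => hgb _)
  obtain ⟨r, hr, hqr⟩ := (stronglyMeasurable_condExp
    (m := MeasurableSpace.comap (X k) inferInstance) (f := Y) (μ := μ)).measurable.exists_eq_measurable_comp
  have hrq : q = r ∘ X k := hqr
  have := hX.isProbabilityMeasure_map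
  have hrL : MemLp r 2 (μ.map (X 0)) := by
    rw [← (hX.measurePreserving k).map_eq, memLp_map_measure_iff hr.aestronglyMeasurable
      (hX.meas k).aemeasurable, ← hrq]
    exact MemLp.of_bound (integrable_condExp.aestronglyMeasurable) 1 hqb
  set G := indicatorConstLp 2 hA hμA (1 : ℝ) with hG
  have hGY : hX.compLp (k + 1) G =ᵐ[μ] Y :=
    (hX.coeFn_compLp _ _).trans ((hX.measurePreserving (k + 1)).quasiMeasurePreserving.ae_eq
      indicatorConstLp_coeFn)
  have hrY : hX.compLp k (hrL.toLp r) =ᵐ[μ] q := by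
    rw [hrq]; exact hX.compLp_toLp k hrL
  have key : ∀ K : Lp ℝ 2 μ, AEStronglyMeasurable[pastSigma X k] K μ →
      inner ℝ K (hX.compLp (k + 1) G) = inner ℝ K (hX.compLp k (hrL.toLp r)) := by
    intro K hK
    have hKi : Integrable K μ := (Lp.memLp K).integrable (by norm_num)
    have hKY : Integrable ((K : Ω → ℝ) * Y) μ := hKi.mul_bdd (c := 1) hYi.aestronglyMeasurable
      (ae_of_all _ fun ω => hgb _)
    have h1 : inner ℝ K (hX.compLp (k + 1) G) = ∫ ω, ((K : Ω → ℝ) * Y) ω ∂μ := by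
      rw [L2.inner_def]
      refine integral_congr_ae ?_
      filter_upwards [hGY] with ω h
      rw [h, real_inner_eq_re_inner, RCLike.inner_apply]
      simp [mul_comm]
    have h2 : inner ℝ K (hX.compLp k (hrL.toLp r)) = ∫ ω, K ω * q ω ∂μ := by
      rw [L2.inner_def]
      refine integral_congr_ae ?_
      filter_upwards [hrY] with ω h
      rw [h, real_inner_eq_re_inner, RCLike.inner_apply]
      simp [mul_comm]
    rw [h1, h2, ← integral_condExp (hX.pastSigma_le k)]
    refine integral_congr_ae ?_
    filter_upwards [condExp_mul_of_aestronglyMeasurable_left hK hKY hYi,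
      hX.markov k g hgm hgb] with ω h3 h4
    rw [h3, Pi.mul_apply, h4]
  have hGr : hX.transition G = hrL.toLp r := by
    refine ext_inner_left ℝ fun a => ?_
    rw [hX.inner_transition k, key _ (hX.aestronglyMeasurable_compLp le_rfl a),
      LinearIsometry.inner_map_map]
  rw [key H hH, hGr]

/-- The Markov property in `L²`. -/
theorem inner_compLp_succ (hX : IsStationaryReversibleMarkov μ X) (k : ℤ)
    {H : Lp ℝ 2 μ} (hH : AEStronglyMeasurable[pastSigma X k] H μ) (b : Lp ℝ 2 (μ.map (X 0))) :
    inner ℝ H (hX.compLp (k + 1) b) = inner ℝ H (hX.compLp k (hX.transition b)) := by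
  refine Lp.induction (by norm_num) (motive := fun b =>
    inner ℝ H (hX.compLp (k + 1) b) = inner ℝ H (hX.compLp k (hX.transition b))) ?_ ?_ ?_ b
  · intro c A hA hμA
    rw [Lp.simpleFunc.coe_indicatorConst]
    have e : indicatorConstLp 2 hA hμA.ne c = c • indicatorConstLp 2 hA hμA.ne (1 : ℝ) := by
      rw [indicatorConstLp, indicatorConstLp, ← MemLp.toLp_const_smul]
      congr 1
      ext x
      by_cases h : x ∈ A <;> simp [h]
    rw [e]
    simp only [map_smul, inner_smul_right]
    rw [hX.inner_compLp_succ_indicator k hH]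
  · intro f g hf hg _ h1 h2
    simp only [map_add, inner_add_right, h1, h2]
  · exact isClosed_eq (by fun_prop) (by fun_prop)

theorem inner_compLp_add (hX : IsStationaryReversibleMarkov μ X) (i : ℤ) (k : ℕ)
    (a b : Lp ℝ 2 (μ.map (X 0))) :
    inner ℝ (hX.compLp i a) (hX.compLp (i + k) b) = inner ℝ a ((hX.transition ^ k) b) := by
  induction k generalizing b with
  | zero => simp
  | succ k ih =>
    rw [Nat.cast_succ, ← add_assoc,
      hX.inner_compLp_succ _ (hX.aestronglyMeasurable_compLp (by omega) a), ih, pow_succ]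
    rfl

theorem condExp_comp_ae_eq (hX : IsStationaryReversibleMarkov μ X) (k : ℤ) {f : ℝ → ℝ}
    (hf : MemLp f 2 (μ.map (X 0))) :
    μ[fun ω => f (X (k + 1) ω) | pastSigma X k]
      =ᵐ[μ] hX.compLp k (hX.transition (hf.toLp f)) := by
  have hfX := hX.compLp_toLp (k + 1) hf
  have hint : ∀ a : Lp ℝ 2 μ, Integrable a μ := fun a => (Lp.memLp a).integrable (by norm_num)
  refine (ae_eq_condExp_of_forall_setIntegral_eq (hX.pastSigma_le k) ((hint _).congr hfX)
    (fun s _ _ => (hint _).integrableOn) (fun s hs _ => ?_)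
    (hX.aestronglyMeasurable_compLp le_rfl _)).symm
  have hs' := hX.pastSigma_le k s hs
  rw [← setIntegral_congr_ae₀ hs'.nullMeasurableSet (hfX.mono fun _ h _ => h)]
  rw [← L2.inner_indicatorConstLp_one hs' (measure_ne_top μ s),
    ← L2.inner_indicatorConstLp_one hs' (measure_ne_top μ s), hX.inner_compLp_succ k]
  refine AEStronglyMeasurable.congr ?_ (indicatorConstLp_coeFn (hs := hs')).symm
  exact (stronglyMeasurable_const.indicator hs).aestronglyMeasurable

theorem norm_sum_compLp_sq_le (hX : IsStationaryReversibleMarkov μ X) (a : ℤ)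
    (h : Lp ℝ 2 (μ.map (X 0))) {n L : ℕ} (hn : n ≤ L + 1) :
    ‖∑ i ∈ Finset.range n, hX.compLp (a + i) h‖ ^ 2
      ≤ n * (2 * (inner ℝ h ((hX.transition ^ 0) h)
        + ∑ k ∈ Finset.range L, inner ℝ h ((hX.transition ^ k) h))) :=
  norm_sum_range_sq_le (v := fun i : ℕ => hX.compLp (a + i) h)
    (d := fun k => inner ℝ h ((hX.transition ^ k) h))
    (fun i k => by rw [Nat.cast_add, ← add_assoc]; exact hX.inner_compLp_add _ k h h)
    (fun j => by rw [inner_pow_two_mul_self hX.transition_symm]; positivity)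
    (fun j => inner_pow_pair_nonneg hX.transition_symm hX.norm_transition_le j h)
    (fun k => abs_inner_pow_le hX.norm_transition_le k h) hn

theorem inner_pow_toLp (hX : IsStationaryReversibleMarkov μ X) {f : ℝ → ℝ}
    (hf : MemLp f 2 (μ.map (X 0))) (k : ℕ) :
    inner ℝ (hf.toLp f) ((hX.transition ^ k) (hf.toLp f))
      = ∫ ω, f (X 0 ω) * f (X (k : ℤ) ω) ∂μ := by
  rw [← hX.inner_compLp_add 0, L2.inner_def, zero_add]
  refine integral_congr_ae ?_
  filter_upwards [hX.compLp_toLp 0 hf, hX.compLp_toLp k hf] with ω h1 h2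
  rw [h1, h2, real_inner_eq_re_inner, RCLike.inner_apply]
  simp [mul_comm]

theorem covR_eq_inner (hX : IsStationaryReversibleMarkov μ X) {f : ℝ → ℝ} (hfm : Measurable f)
    (hf : MemLp f 2 (μ.map (X 0)))
    (hf' : MemLp (fun x => f x - ∫ ω, f (X 0 ω) ∂μ) 2 (μ.map (X 0))) (k : ℕ) :
    covR μ (fun ω => f (X 0 ω)) (fun ω => f (X (k : ℤ) ω))
      = inner ℝ (hf'.toLp _) ((hX.transition ^ k) (hf'.toLp _)) := by
  rw [hX.inner_pow_toLp, covR, hX.integral_comp hfm k]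
  set m := ∫ ω, f (X 0 ω) ∂μ with hm
  have hk : Integrable (fun ω => f (X (k : ℤ) ω)) μ :=
    (hX.memLp_comp hf k).integrable (by norm_num)
  have h0 : Integrable (fun ω => f (X 0 ω)) μ := (hX.memLp_comp hf 0).integrable (by norm_num)
  have h0k : Integrable (fun ω => f (X 0 ω) * f (X (k : ℤ) ω)) μ :=
    (hX.memLp_comp hf 0).integrable_mul (hX.memLp_comp hf k)
  have e : ∀ ω, (f (X 0 ω) - m) * (f (X (k : ℤ) ω) - m)
      = f (X 0 ω) * f (X (k : ℤ) ω) - m * f (X 0 ω) - m * f (X (k : ℤ) ω) + m * m := fun ω => by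
    ring
  have h1 : Integrable (fun ω => f (X 0 ω) * f (X (k : ℤ) ω) - m * f (X 0 ω)) μ :=
    h0k.sub (h0.const_mul m)
  have h2 : Integrable
      (fun ω => f (X 0 ω) * f (X (k : ℤ) ω) - m * f (X 0 ω) - m * f (X (k : ℤ) ω)) μ :=
    h1.sub (hk.const_mul m)
  simp_rw [e]
  rw [integral_add h2 (integrable_const _), integral_sub h1 (hk.const_mul m), integral_sub h0k (h0.const_mul m),
    integral_const_mul, integral_const_mul, hX.integral_comp hfm k, ← hm]
  simp

theorem integral_sq_condExp_comp (hX : IsStationaryReversibleMarkov μ X) (k : ℤ) {f : ℝ → ℝ}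
    (hf : MemLp f 2 (μ.map (X 0))) :
    ∫ ω, (μ[fun ω => f (X (k + 1) ω) | pastSigma X k] ω) ^ 2 ∂μ
      = inner ℝ (hf.toLp f) ((hX.transition ^ 2) (hf.toLp f)) := by
  have h := inner_pow_two_mul_self hX.transition_symm 1 (hf.toLp f)
  rw [mul_one, pow_one] at h
  rw [h, ← LinearIsometry.norm_map (hX.compLp k), ← real_inner_self_eq_norm_sq, L2.inner_def]
  refine integral_congr_ae ?_
  filter_upwards [hX.condExp_comp_ae_eq k hf] with ω h1
  rw [h1, real_inner_self_eq_norm_sq, Real.norm_eq_abs, sq_abs]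

theorem integral_sq_sum_condExp_le (hX : IsStationaryReversibleMarkov μ X) {f : ℝ → ℝ}
    (hf : MemLp f 2 (μ.map (X 0))) (n : ℕ) :
    ∫ ω, (∑ k ∈ Finset.range n, μ[fun ω => f (X ((k : ℤ) + 1) ω) | pastSigma X k] ω) ^ 2 ∂μ
      ≤ n * (2 * (inner ℝ (hf.toLp f) ((hX.transition ^ 2) (hf.toLp f))
        + ∑ k ∈ Finset.Icc 2 n, inner ℝ (hf.toLp f) ((hX.transition ^ k) (hf.toLp f)))) := by
  set F := hf.toLp f
  have hsum : (∑ i ∈ Finset.range n, hX.compLp (0 + i) (hX.transition F) : Lp ℝ 2 μ)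
      =ᵐ[μ] fun ω => ∑ k ∈ Finset.range n, μ[fun ω => f (X ((k : ℤ) + 1) ω) | pastSigma X k] ω := by
    refine (Lp.coeFn_finsetSum _ _).trans ?_
    have : ∀ᵐ ω ∂μ, ∀ k : ℕ, μ[fun ω => f (X ((k : ℤ) + 1) ω) | pastSigma X k] ω
        = hX.compLp k (hX.transition F) ω :=
      ae_all_iff.2 fun k => hX.condExp_comp_ae_eq k hf
    filter_upwards [this] with ω h
    simp [h]
  rw [integral_sq_eq_norm_sq hsum]
  refine (hX.norm_sum_compLp_sq_le 0 (hX.transition F) (n := n) (L := n - 1) (by omega)).trans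
    (le_of_eq ?_)
  have e : ∀ k, inner ℝ (hX.transition F) ((hX.transition ^ k) (hX.transition F))
      = inner ℝ F ((hX.transition ^ (2 + k)) F) := fun k => by
    rw [hX.transition_symm, show 2 + k = 1 + (k + 1) by ring, pow_add, pow_add, pow_one]
    rfl
  simp_rw [e]
  rw [← Finset.Ico_succ_right_eq_Icc, Finset.sum_Ico_eq_sum_range]
  rfl

theorem integral_sq_sum_comp_le (hX : IsStationaryReversibleMarkov μ X) {f : ℝ → ℝ}
    (hf : MemLp f 2 (μ.map (X 0))) (n : ℕ) :
    ∫ ω, (∑ k ∈ Finset.range n, f (X ((k : ℤ) + 1) ω)) ^ 2 ∂μ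
      ≤ n * (2 * (inner ℝ (hf.toLp f) ((hX.transition ^ 0) (hf.toLp f))
        + ∑ k ∈ Finset.Icc 0 n, inner ℝ (hf.toLp f) ((hX.transition ^ k) (hf.toLp f)))) := by
  set F := hf.toLp f
  have hsum : (∑ i ∈ Finset.range n, hX.compLp (1 + i) F : Lp ℝ 2 μ)
      =ᵐ[μ] fun ω => ∑ k ∈ Finset.range n, f (X ((k : ℤ) + 1) ω) := by
    refine (Lp.coeFn_finsetSum _ _).trans ?_
    have : ∀ᵐ ω ∂μ, ∀ k : ℕ, hX.compLp (1 + k) F ω = f (X (k + 1) ω) :=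
      ae_all_iff.2 fun k => by
        rw [add_comm (k : ℤ) 1]
        exact hX.compLp_toLp _ hf
    filter_upwards [this] with ω h
    simp [h]
  rw [integral_sq_eq_norm_sq hsum]
  refine (hX.norm_sum_compLp_sq_le 1 F (n := n) (L := n + 1) (by omega)).trans (le_of_eq ?_)
  rw [Finset.range_eq_Ico, ← Finset.Ico_succ_right_eq_Icc]
  rfl

theorem condExp_comp_pow_four_le (hX : IsStationaryReversibleMarkov μ X) (k : ℤ) {f : ℝ → ℝ}
    (hfm : Measurable f) (hf4 : ∀ k, Integrable (fun ω => f (X k ω) ^ 4) μ)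
    (hf : MemLp f 2 (μ.map (X 0))) :
    Integrable (fun ω => (μ[fun ω => f (X (k + 1) ω) | pastSigma X k] ω) ^ 4) μ ∧
      ∫ ω, (μ[fun ω => f (X (k + 1) ω) | pastSigma X k] ω) ^ 4 ∂μ ≤ ∫ ω, f (X 0 ω) ^ 4 ∂μ := by
  have hJ := (Even.convexOn_pow (𝕜 := ℝ) (n := 4) (by decide)).map_condExp_le_univ
    (hX.pastSigma_le k) (continuous_pow 4).lowerSemicontinuous
    ((hX.memLp_comp hf (k + 1)).integrable (by norm_num)) (hf4 (k + 1))
  have hi : Integrable (fun ω => (μ[fun ω => f (X (k + 1) ω) | pastSigma X k] ω) ^ 4) μ := by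
    refine Integrable.mono' (integrable_condExp (m := pastSigma X k)
      (f := (fun x : ℝ => x ^ 4) ∘ fun ω => f (X (k + 1) ω)))
      (integrable_condExp.aestronglyMeasurable.pow 4) ?_
    filter_upwards [hJ] with ω h
    rw [Real.norm_of_nonneg (by positivity)]
    exact h
  refine ⟨hi, (integral_mono_ae hi integrable_condExp hJ).trans (le_of_eq ?_)⟩
  rw [integral_condExp (hX.pastSigma_le k)]
  exact hX.integral_comp (hfm.pow_const 4) (k + 1)

end IsStationaryReversibleMarkov

end Chain

section CauchySchwarz

variable {Ω : Type*} [MeasurableSpace Ω] {μ : Measure Ω}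

theorem integral_abs_mul_le_sqrt_mul_sqrt {f g : Ω → ℝ} (hf : MemLp f 2 μ) (hg : MemLp g 2 μ) :
    ∫ ω, |f ω * g ω| ∂μ ≤ √(∫ ω, f ω ^ 2 ∂μ) * √(∫ ω, g ω ^ 2 ∂μ) := by
  have e : ENNReal.ofReal 2 = 2 := by simp
  have h := integral_mul_le_Lp_mul_Lq_of_nonneg (μ := μ) (f := fun ω => |f ω|)
    (g := fun ω => |g ω|) Real.HolderConjugate.two_two (ae_of_all _ fun _ => abs_nonneg _)
    (ae_of_all _ fun _ => abs_nonneg _) (e ▸ hf.abs) (e ▸ hg.abs)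
  simpa only [abs_mul, Real.rpow_two, sq_abs, Real.sqrt_eq_rpow] using h

theorem integral_abs_le_sqrt [IsProbabilityMeasure μ] {f : Ω → ℝ} (hf : MemLp f 2 μ) :
    ∫ ω, |f ω| ∂μ ≤ √(∫ ω, f ω ^ 2 ∂μ) := by
  simpa using integral_abs_mul_le_sqrt_mul_sqrt hf (memLp_const (1 : ℝ))

theorem memLp_two_sq_of_integrable_pow_four {f : Ω → ℝ} (hf : AEStronglyMeasurable f μ)
    (h4 : Integrable (fun ω => f ω ^ 4) μ) : MemLp (fun ω => f ω ^ 2) 2 μ := by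
  refine (memLp_two_iff_integrable_sq (hf.pow 2)).2 ?_
  simpa only [Pi.pow_apply, ← pow_mul] using h4

theorem memLp_two_of_integrable_pow_four [IsFiniteMeasure μ] {f : Ω → ℝ}
    (hf : AEStronglyMeasurable f μ) (h4 : Integrable (fun ω => f ω ^ 4) μ) : MemLp f 2 μ := by
  rw [memLp_two_iff_integrable_sq hf]
  exact (memLp_two_sq_of_integrable_pow_four hf h4).integrable (by norm_num)

theorem integral_sq_sub_le {f g : Ω → ℝ} (hf : MemLp f 2 μ) (hg : MemLp g 2 μ) :
    ∫ ω, (f ω - g ω) ^ 2 ∂μ ≤ 2 * (∫ ω, f ω ^ 2 ∂μ + ∫ ω, g ω ^ 2 ∂μ) := by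
  rw [← integral_add hf.integrable_sq hg.integrable_sq, ← integral_const_mul]
  exact integral_mono (hf.sub hg).integrable_sq
    ((hf.integrable_sq.add hg.integrable_sq).const_mul 2)
    fun ω => by nlinarith [sq_nonneg (f ω + g ω)]

theorem integral_abs_sub_sq_sub_sq_le {f g : Ω → ℝ} (hf : MemLp f 2 μ) (hg : MemLp g 2 μ) :
    ∫ ω, |(f ω - g ω) ^ 2 - f ω ^ 2| ∂μ
      ≤ ∫ ω, g ω ^ 2 ∂μ + 2 * (√(∫ ω, f ω ^ 2 ∂μ) * √(∫ ω, g ω ^ 2 ∂μ)) := by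
  have hfg : Integrable (fun ω => |f ω * g ω|) μ := (hf.integrable_mul hg).abs
  refine le_trans ?_ (add_le_add_right (mul_le_mul_of_nonneg_left
    (integral_abs_mul_le_sqrt_mul_sqrt hf hg) two_pos.le) _)
  rw [← integral_const_mul, ← integral_add hg.integrable_sq (hfg.const_mul 2)]
  refine integral_mono ((hf.sub hg).integrable_sq.sub hf.integrable_sq).abs
    (hg.integrable_sq.add (hfg.const_mul 2)) fun ω => ?_
  have h : (f ω - g ω) ^ 2 - f ω ^ 2 = g ω ^ 2 - 2 * (f ω * g ω) := by ring
  simp only [h]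
  refine (abs_sub _ _).trans ?_
  rw [abs_mul, abs_of_nonneg (sq_nonneg (g ω)), abs_two]

theorem integrable_sub_pow_four {f g : Ω → ℝ} (hfm : AEStronglyMeasurable f μ)
    (hgm : AEStronglyMeasurable g μ) (hf : Integrable (fun ω => f ω ^ 4) μ)
    (hg : Integrable (fun ω => g ω ^ 4) μ) :
    Integrable (fun ω => (f ω - g ω) ^ 4) μ ∧
      ∫ ω, (f ω - g ω) ^ 4 ∂μ ≤ 8 * (∫ ω, f ω ^ 4 ∂μ + ∫ ω, g ω ^ 4 ∂μ) := by
  have key : ∀ ω, (f ω - g ω) ^ 4 ≤ 8 * (f ω ^ 4 + g ω ^ 4) := fun ω => by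
    nlinarith [sq_nonneg (f ω + g ω), sq_nonneg (f ω - g ω), sq_nonneg (f ω ^ 2 - g ω ^ 2),
      mul_nonneg (sq_nonneg (f ω + g ω)) (sq_nonneg (f ω - g ω)),
      sq_nonneg ((f ω + g ω) ^ 2)]
  have hi : Integrable (fun ω => (f ω - g ω) ^ 4) μ := by
    refine Integrable.mono' ((hf.add hg).const_mul 8) ((hfm.sub hgm).pow 4) (ae_of_all _ fun ω => ?_)
    rw [Real.norm_of_nonneg (by positivity)]
    exact key ω
  refine ⟨hi, ?_⟩
  rw [← integral_add hf hg, ← integral_const_mul]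
  exact integral_mono hi ((hf.add hg).const_mul 8) key

end CauchySchwarz

section Innovation

variable {Ω : Type*} [MeasurableSpace Ω] {μ : Measure Ω} {X : ℤ → Ω → ℝ} {f : ℝ → ℝ}

/-- The one-step prediction of `f (X (k + 1))` from the past up to time `k`. -/
def prediction (μ : Measure Ω) (X : ℤ → Ω → ℝ) (f : ℝ → ℝ) (k : ℤ) : Ω → ℝ :=
  μ[fun ω => f (X (k + 1) ω) | pastSigma X k]

/-- The martingale difference `f (X (k + 1)) - E[f (X (k + 1)) | past up to k]`. -/
def innovation (μ : Measure Ω) (X : ℤ → Ω → ℝ) (f : ℝ → ℝ) (k : ℤ) (ω : Ω) : ℝ :=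
  f (X (k + 1) ω) - prediction μ X f k ω

namespace IsStationaryReversibleMarkov

theorem measurable_innovation (hfm : Measurable f) (k : ℤ) :
    Measurable[pastSigma X (k + 1)] (innovation μ X f k) :=
  (hfm.comp (measurable_pastSigma X le_rfl)).sub
    (stronglyMeasurable_condExp.measurable.mono (monotone_pastSigma X (by omega)) le_rfl)

theorem memLp_sq_of_integrable_pow_four (hX : IsStationaryReversibleMarkov μ X)
    (hfm : Measurable f) (hf4 : ∀ k, Integrable (fun ω => f (X k ω) ^ 4) μ) :
    MemLp (fun x => f x ^ 2) 2 (μ.map (X 0)) := by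
  rw [memLp_map_measure_iff (hfm.pow_const 2).aestronglyMeasurable (hX.meas 0).aemeasurable]
  exact memLp_two_sq_of_integrable_pow_four (hfm.comp (hX.meas 0)).aestronglyMeasurable (hf4 0)

theorem memLp_prediction (hX : IsStationaryReversibleMarkov μ X)
    (hf : MemLp f 2 (μ.map (X 0))) (k : ℤ) : MemLp (prediction μ X f k) 2 μ :=
  (hX.memLp_comp hf (k + 1)).condExp (by norm_num)

theorem memLp_innovation (hX : IsStationaryReversibleMarkov μ X)
    (hf : MemLp f 2 (μ.map (X 0))) (k : ℤ) : MemLp (innovation μ X f k) 2 μ :=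
  (hX.memLp_comp hf (k + 1)).sub (hX.memLp_prediction hf k)

variable [IsProbabilityMeasure μ]

theorem memLp_of_integrable_pow_four (hX : IsStationaryReversibleMarkov μ X) (hfm : Measurable f)
    (hf4 : ∀ k, Integrable (fun ω => f (X k ω) ^ 4) μ) : MemLp f 2 (μ.map (X 0)) := by
  rw [memLp_map_measure_iff hfm.aestronglyMeasurable (hX.meas 0).aemeasurable]
  exact memLp_two_of_integrable_pow_four (hfm.comp (hX.meas 0)).aestronglyMeasurable (hf4 0)

theorem condExp_innovation (hX : IsStationaryReversibleMarkov μ X)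
    (hf : MemLp f 2 (μ.map (X 0))) (k : ℤ) : μ[innovation μ X f k | pastSigma X k] =ᵐ[μ] 0 := by
  have hi : Integrable (fun ω => f (X (k + 1) ω)) μ :=
    (hX.memLp_comp hf (k + 1)).integrable (by norm_num)
  refine (condExp_sub hi integrable_condExp (pastSigma X k)).trans ?_
  rw [condExp_of_stronglyMeasurable (hX.pastSigma_le k) stronglyMeasurable_condExp
    integrable_condExp, sub_self]

theorem integral_sq_prediction (hX : IsStationaryReversibleMarkov μ X)
    (hf : MemLp f 2 (μ.map (X 0))) (hmean : ∫ ω, f (X 0 ω) ∂μ = 0) (k : ℤ) :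
    ∫ ω, prediction μ X f k ω ^ 2 ∂μ = covR μ (fun ω => f (X 0 ω)) (fun ω => f (X 2 ω)) := by
  rw [covR, hmean, zero_mul, sub_zero]
  exact (hX.integral_sq_condExp_comp k hf).trans (hX.inner_pow_toLp hf 2)

theorem integral_sq_innovation_le (hX : IsStationaryReversibleMarkov μ X) (hfm : Measurable f)
    (hf : MemLp f 2 (μ.map (X 0))) (hmean : ∫ ω, f (X 0 ω) ∂μ = 0) (k : ℤ) :
    ∫ ω, innovation μ X f k ω ^ 2 ∂μ ≤ 2 * (∫ ω, f (X 0 ω) ^ 2 ∂μ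
      + covR μ (fun ω => f (X 0 ω)) (fun ω => f (X 2 ω))) := by
  rw [← hX.integral_sq_prediction hf hmean k, ← hX.integral_comp (hfm.pow_const 2) (k + 1)]
  exact integral_sq_sub_le (hX.memLp_comp hf (k + 1)) (hX.memLp_prediction hf k)

theorem innovation_pow_four (hX : IsStationaryReversibleMarkov μ X) (hfm : Measurable f)
    (hf4 : ∀ k, Integrable (fun ω => f (X k ω) ^ 4) μ) (k : ℤ) :
    Integrable (fun ω => innovation μ X f k ω ^ 4) μ ∧
      ∫ ω, innovation μ X f k ω ^ 4 ∂μ ≤ 16 * ∫ ω, f (X 0 ω) ^ 4 ∂μ := by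
  have hf := hX.memLp_of_integrable_pow_four hfm hf4
  obtain ⟨h1, h2⟩ := hX.condExp_comp_pow_four_le k hfm hf4 hf
  obtain ⟨h3, h4⟩ := integrable_sub_pow_four (hX.memLp_comp hf (k + 1)).aestronglyMeasurable
    (hX.memLp_prediction hf k).aestronglyMeasurable (hf4 (k + 1)) h1
  refine ⟨h3, h4.trans ?_⟩
  rw [hX.integral_comp (hfm.pow_const 4) (k + 1)]
  unfold prediction
  linarith

theorem innovation_abs_pow_three (hX : IsStationaryReversibleMarkov μ X) (hfm : Measurable f)
    (hf4 : ∀ k, Integrable (fun ω => f (X k ω) ^ 4) μ) (hmean : ∫ ω, f (X 0 ω) ∂μ = 0) (k : ℤ) :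
    Integrable (fun ω => |innovation μ X f k ω| ^ 3) μ ∧
      ∫ ω, |innovation μ X f k ω| ^ 3 ∂μ
        ≤ √(2 * (∫ ω, f (X 0 ω) ^ 2 ∂μ + covR μ (fun ω => f (X 0 ω)) (fun ω => f (X 2 ω))))
          * √(16 * ∫ ω, f (X 0 ω) ^ 4 ∂μ) := by
  have hf := hX.memLp_of_integrable_pow_four hfm hf4
  have hD := hX.memLp_innovation hf k
  obtain ⟨h4, h4'⟩ := hX.innovation_pow_four hfm hf4 k
  have hD2 := memLp_two_sq_of_integrable_pow_four hD.aestronglyMeasurable h4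
  have e : ∀ ω, |innovation μ X f k ω| ^ 3
      = |innovation μ X f k ω * innovation μ X f k ω ^ 2| := fun ω => by
    rw [abs_mul, abs_pow]; ring
  simp_rw [e]
  refine ⟨(hD.integrable_mul hD2).abs, (integral_abs_mul_le_sqrt_mul_sqrt hD hD2).trans ?_⟩
  refine mul_le_mul (Real.sqrt_le_sqrt (hX.integral_sq_innovation_le hfm hf hmean k))
    (Real.sqrt_le_sqrt ?_) (Real.sqrt_nonneg _) (Real.sqrt_nonneg _)
  simpa only [← pow_mul] using h4'

theorem integral_abs_sum_sq_innovation_sub_le (hX : IsStationaryReversibleMarkov μ X)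
    (hfm : Measurable f) (hf4 : ∀ k, Integrable (fun ω => f (X k ω) ^ 4) μ)
    (hmean : ∫ ω, f (X 0 ω) ∂μ = 0) {n : ℕ} (hn : n ≠ 0) (s : ℝ) :
    ∫ ω, |(n : ℝ)⁻¹ * ∑ k ∈ Finset.range n, innovation μ X f k ω ^ 2 - s| ∂μ
      ≤ covR μ (fun ω => f (X 0 ω)) (fun ω => f (X 2 ω))
        + 2 * (√(∫ ω, f (X 0 ω) ^ 2 ∂μ)
          * √(covR μ (fun ω => f (X 0 ω)) (fun ω => f (X 2 ω))))
        + √(2 * ((1 / (n : ℝ)) * (covR μ (fun ω => f (X 0 ω) ^ 2) (fun ω => f (X 0 ω) ^ 2)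
          + ∑ u ∈ Finset.Icc 0 n, covR μ (fun ω => f (X 0 ω) ^ 2)
            (fun ω => f (X (u : ℤ) ω) ^ 2))))
        + |∫ ω, f (X 0 ω) ^ 2 ∂μ - s| := by
  have hf := hX.memLp_of_integrable_pow_four hfm hf4
  have hf2 := hX.memLp_sq_of_integrable_pow_four hfm hf4
  have hn0 : (n : ℝ) ≠ 0 := Nat.cast_ne_zero.2 hn
  have hnpos : (0 : ℝ) < n := by positivity
  have := hX.isProbabilityMeasure_map
  set m := ∫ ω, f (X 0 ω) ^ 2 ∂μ with hm
  have hg : MemLp (fun x => f x ^ 2 - m) 2 (μ.map (X 0)) := hf2.sub (memLp_const m)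
  set U : ℕ → Ω → ℝ := fun k ω => innovation μ X f k ω ^ 2 - f (X ((k : ℤ) + 1) ω) ^ 2 with hU
  set V : Ω → ℝ := fun ω => ∑ k ∈ Finset.range n, (f (X ((k : ℤ) + 1) ω) ^ 2 - m) with hV
  have hUi : ∀ k : ℕ, Integrable (U k) μ := fun k =>
    (hX.memLp_innovation hf k).integrable_sq.sub (hX.memLp_comp hf (k + 1)).integrable_sq
  have hVL : MemLp V 2 μ := memLp_finsetSum _ fun k _ => hX.memLp_comp hg ((k : ℤ) + 1)
  have hUb : ∀ k : ℕ, ∫ ω, |U k ω| ∂μ ≤ covR μ (fun ω => f (X 0 ω)) (fun ω => f (X 2 ω))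
        + 2 * (√m * √(covR μ (fun ω => f (X 0 ω)) (fun ω => f (X 2 ω)))) := fun k => by
    have h := integral_abs_sub_sq_sub_sq_le (hX.memLp_comp hf (k + 1)) (hX.memLp_prediction hf k)
    rwa [hX.integral_sq_prediction hf hmean k, hX.integral_comp (hfm.pow_const 2) (k + 1)] at h
  have hVb : (n : ℝ)⁻¹ * ∫ ω, |V ω| ∂μ ≤ √(2 * ((1 / (n : ℝ))
      * (covR μ (fun ω => f (X 0 ω) ^ 2) (fun ω => f (X 0 ω) ^ 2)
          + ∑ u ∈ Finset.Icc 0 n, covR μ (fun ω => f (X 0 ω) ^ 2)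
            (fun ω => f (X (u : ℤ) ω) ^ 2)))) := by
    have h0 := hX.covR_eq_inner (hfm.pow_const 2) hf2 hg 0
    have hk := fun k : ℕ => hX.covR_eq_inner (hfm.pow_const 2) hf2 hg k
    rw [Nat.cast_zero] at h0
    rw [h0]
    simp_rw [hk]
    refine Real.le_sqrt_of_sq_le ?_
    have h1 := (integral_abs_le_sqrt hVL)
    have h2 := hX.integral_sq_sum_comp_le hg n
    have h3 : (∫ ω, |V ω| ∂μ) ^ 2 ≤ ∫ ω, V ω ^ 2 ∂μ := by
      have h4 : 0 ≤ ∫ ω, V ω ^ 2 ∂μ := integral_nonneg fun ω => sq_nonneg _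
      calc _ ≤ √(∫ ω, V ω ^ 2 ∂μ) ^ 2 :=
            pow_le_pow_left₀ (integral_nonneg fun ω => abs_nonneg _) h1 2
        _ = _ := Real.sq_sqrt h4
    rw [mul_pow]
    refine (mul_le_mul_of_nonneg_left (h3.trans h2) (by positivity)).trans (le_of_eq ?_)
    field_simp
    rfl
  have hsum : Integrable (fun ω => ∑ k ∈ Finset.range n, |U k ω|) μ :=
    integrable_finsetSum _ fun k _ => (hUi k).abs
  have hVi : Integrable (fun ω => |V ω|) μ := (hVL.integrable (by norm_num)).abs
  have hpt : ∀ ω, |(n : ℝ)⁻¹ * ∑ k ∈ Finset.range n, innovation μ X f k ω ^ 2 - s|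
      ≤ (n : ℝ)⁻¹ * ∑ k ∈ Finset.range n, |U k ω| + (n : ℝ)⁻¹ * |V ω| + |m - s| := fun ω => by
    have e : (n : ℝ)⁻¹ * ∑ k ∈ Finset.range n, innovation μ X f k ω ^ 2 - s
        = (n : ℝ)⁻¹ * ∑ k ∈ Finset.range n, U k ω + (n : ℝ)⁻¹ * V ω + (m - s) := by
      simp only [hU, hV, Finset.sum_sub_distrib, Finset.sum_const, Finset.card_range, nsmul_eq_mul]
      field_simp
      ring
    rw [e]
    refine (abs_add_three _ _ _).trans (add_le_add_left (add_le_add ?_ ?_) _)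
    · rw [abs_mul, abs_of_pos (inv_pos.2 hnpos)]
      exact mul_le_mul_of_nonneg_left (Finset.abs_sum_le_sum_abs _ _) (by positivity)
    · rw [abs_mul, abs_of_pos (inv_pos.2 hnpos)]
  have hi12 : Integrable (fun ω => (n : ℝ)⁻¹ * ∑ k ∈ Finset.range n, |U k ω|
      + (n : ℝ)⁻¹ * |V ω|) μ := (hsum.const_mul _).add (hVi.const_mul _)
  refine (integral_mono_of_nonneg (ae_of_all _ fun ω => abs_nonneg _)
    (hi12.add (integrable_const _)) (ae_of_all _ hpt)).trans ?_
  simp only [Pi.add_apply]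
  rw [integral_add hi12 (integrable_const _),
    integral_add (hsum.const_mul _) (hVi.const_mul _), integral_const_mul, integral_const_mul,
    integral_finsetSum _ fun k _ => (hUi k).abs]
  refine add_le_add (add_le_add ?_ hVb) (by simp)
  refine (mul_le_mul_of_nonneg_left (Finset.sum_le_sum fun k _ => hUb k) (by positivity)).trans
    (le_of_eq ?_)
  rw [Finset.sum_const, Finset.card_range, nsmul_eq_mul, inv_mul_cancel_left₀ hn0]

theorem covR_two_nonneg (hX : IsStationaryReversibleMarkov μ X)
    (hf : MemLp f 2 (μ.map (X 0))) (hmean : ∫ ω, f (X 0 ω) ∂μ = 0) :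
    0 ≤ covR μ (fun ω => f (X 0 ω)) (fun ω => f (X 2 ω)) := by
  rw [← hX.integral_sq_prediction hf hmean 0]
  exact integral_nonneg fun ω => sq_nonneg _

theorem covR_eq_inner_of_integral_eq_zero (hX : IsStationaryReversibleMarkov μ X)
    (hf : MemLp f 2 (μ.map (X 0))) (hmean : ∫ ω, f (X 0 ω) ∂μ = 0) (k : ℕ) :
    covR μ (fun ω => f (X 0 ω)) (fun ω => f (X (k : ℤ) ω))
      = inner ℝ (hf.toLp f) ((hX.transition ^ k) (hf.toLp f)) := by
  rw [covR, hmean, zero_mul, sub_zero, hX.inner_pow_toLp]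

theorem sum_covR_nonneg (hX : IsStationaryReversibleMarkov μ X)
    (hf : MemLp f 2 (μ.map (X 0))) (hmean : ∫ ω, f (X 0 ω) ∂μ = 0) (n : ℕ) :
    0 ≤ ∑ k ∈ Finset.Icc 2 n, covR μ (fun ω => f (X 0 ω)) (fun ω => f (X (k : ℤ) ω)) := by
  simp_rw [hX.covR_eq_inner_of_integral_eq_zero hf hmean]
  rw [← Finset.Ico_succ_right_eq_Icc, Finset.sum_Ico_eq_sum_range]
  exact hX.sum_inner_pow_nonneg _ _ 1

theorem integral_abs_sum_prediction_le (hX : IsStationaryReversibleMarkov μ X)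
    (hf : MemLp f 2 (μ.map (X 0))) (hmean : ∫ ω, f (X 0 ω) ∂μ = 0) (n : ℕ) :
    ∫ ω, |∑ k ∈ Finset.range n, prediction μ X f k ω| ∂μ
      ≤ √n * √(2 * (covR μ (fun ω => f (X 0 ω)) (fun ω => f (X 2 ω))
        + ∑ k ∈ Finset.Icc 2 n, covR μ (fun ω => f (X 0 ω)) (fun ω => f (X (k : ℤ) ω)))) := by
  have h2 := hX.covR_eq_inner_of_integral_eq_zero hf hmean 2
  rw [Nat.cast_ofNat] at h2
  rw [h2]
  simp_rw [hX.covR_eq_inner_of_integral_eq_zero hf hmean]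
  rw [← Real.sqrt_mul (Nat.cast_nonneg n)]
  exact (integral_abs_le_sqrt (memLp_finsetSum _ fun (k : ℕ) _ => hX.memLp_prediction hf k)).trans
    (Real.sqrt_le_sqrt (hX.integral_sq_sum_condExp_le hf n))

theorem inv_mul_integral_pow_four_le (hX : IsStationaryReversibleMarkov μ X)
    (hfm : Measurable f) (hf4 : ∀ k, Integrable (fun ω => f (X k ω) ^ 4) μ) (n : ℕ) :
    (1 / (n : ℝ)) * ∫ ω, f (X 0 ω) ^ 4 ∂μ
      ≤ (1 / (n : ℝ)) * (covR μ (fun ω => f (X 0 ω) ^ 2) (fun ω => f (X 0 ω) ^ 2)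
          + ∑ u ∈ Finset.Icc 0 n, covR μ (fun ω => f (X 0 ω) ^ 2)
            (fun ω => f (X (u : ℤ) ω) ^ 2))
        + (1 / (n : ℝ)) * (∫ ω, f (X 0 ω) ^ 2 ∂μ) ^ 2 := by
  have hf2 := hX.memLp_sq_of_integrable_pow_four hfm hf4
  have := hX.isProbabilityMeasure_map
  have hg : MemLp (fun x => f x ^ 2 - ∫ ω, f (X 0 ω) ^ 2 ∂μ) 2 (μ.map (X 0)) :=
    hf2.sub (memLp_const _)
  have hs : 0 ≤ ∑ u ∈ Finset.Icc 0 n, covR μ (fun ω => f (X 0 ω) ^ 2)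
      (fun ω => f (X (u : ℤ) ω) ^ 2) := by
    have hk := fun k : ℕ => hX.covR_eq_inner (hfm.pow_const 2) hf2 hg k
    simp_rw [hk]
    rw [← Finset.Ico_succ_right_eq_Icc, ← Finset.range_eq_Ico]
    simpa using hX.sum_inner_pow_nonneg (hg.toLp _) (n + 1) 0
  have h0 : covR μ (fun ω => f (X 0 ω) ^ 2) (fun ω => f (X 0 ω) ^ 2)
      = ∫ ω, f (X 0 ω) ^ 4 ∂μ - (∫ ω, f (X 0 ω) ^ 2 ∂μ) ^ 2 := by
    rw [covR, sq (∫ ω, f (X 0 ω) ^ 2 ∂μ)]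
    simp_rw [← pow_add]
  rw [h0, ← mul_add]
  exact mul_le_mul_of_nonneg_left (by linarith) (by positivity)

end IsStationaryReversibleMarkov

end Innovation

section RowBound

variable {Ω : Type*} [MeasurableSpace Ω] {μ : Measure Ω} [IsProbabilityMeasure μ]
  {X : ℤ → Ω → ℝ} {f : ℝ → ℝ}

theorem norm_integral_cexp_sub_cexp_le {Y Z : Ω → ℝ} (hY : Measurable Y) (hZ : AEMeasurable Z μ)
    (hYZ : Integrable (fun ω => Y ω - Z ω) μ) (t : ℝ) :
    ‖∫ ω, Complex.exp ((t * Y ω : ℝ) * Complex.I) ∂μ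
      - ∫ ω, Complex.exp ((t * Z ω : ℝ) * Complex.I) ∂μ‖ ≤ |t| * ∫ ω, |Y ω - Z ω| ∂μ := by
  have hi : ∀ {W : Ω → ℝ}, AEMeasurable W μ →
      Integrable (fun ω => Complex.exp ((t * W ω : ℝ) * Complex.I)) μ := fun hW =>
    Integrable.of_bound (C := 1) (by fun_prop)
      (ae_of_all _ fun ω => (Complex.norm_exp_ofReal_mul_I _).le)
  rw [← integral_sub (hi hY.aemeasurable) (hi hZ), ← integral_const_mul]
  refine norm_integral_le_of_norm_le (hYZ.abs.const_mul |t|) (ae_of_all _ fun ω => ?_)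
  have e : Complex.exp ((t * Y ω : ℝ) * Complex.I) - Complex.exp ((t * Z ω : ℝ) * Complex.I)
      = Complex.exp ((t * Z ω : ℝ) * Complex.I)
        * (Complex.exp (Complex.I * (t * (Y ω - Z ω) : ℝ)) - 1) := by
    rw [mul_sub, ← Complex.exp_add, mul_one]
    congr 2
    push_cast
    ring
  rw [e, norm_mul, Complex.norm_exp_ofReal_mul_I, one_mul]
  refine Real.norm_exp_I_mul_ofReal_sub_one_le.trans ?_
  rw [Real.norm_eq_abs, abs_mul]

namespace IsStationaryReversibleMarkov

theorem norm_integral_cexp_sum_sub_le (hX : IsStationaryReversibleMarkov μ X) (hfm : Measurable f)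
    (hf4 : ∀ k, Integrable (fun ω => f (X k ω) ^ 4) μ) (hmean : ∫ ω, f (X 0 ω) ∂μ = 0)
    {n : ℕ} (hn : n ≠ 0) {s ε m c Q₁ Q₂ A L : ℝ} (hs : 0 ≤ s) (hε : 0 < ε) (t : ℝ)
    (hm : m = ∫ ω, f (X 0 ω) ^ 2 ∂μ)
    (hc : c = covR μ (fun ω => f (X 0 ω)) (fun ω => f (X 2 ω)))
    (hQ₁ : Q₁ = c + ∑ k ∈ Finset.Icc 2 n, covR μ (fun ω => f (X 0 ω)) (fun ω => f (X (k : ℤ) ω)))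
    (hQ₂ : Q₂ = (1 / (n : ℝ)) * (covR μ (fun ω => f (X 0 ω) ^ 2) (fun ω => f (X 0 ω) ^ 2)
          + ∑ u ∈ Finset.Icc 0 n, covR μ (fun ω => f (X 0 ω) ^ 2)
            (fun ω => f (X (u : ℤ) ω) ^ 2)))
    (hA : A = c + 2 * (√m * √c) + √(2 * Q₂) + |m - s|)
    (hL : L = √(2 * (m + c)) * √(16 * (Q₂ + 1 / (n : ℝ) * m ^ 2))) :
    ‖∫ ω, Complex.exp
          ((t * (1 / √n * ∑ k ∈ Finset.Icc 1 n, f (X (k : ℤ) ω)) : ℝ) * Complex.I) ∂μ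
        - Complex.exp (-(t ^ 2 * s / 2) : ℝ)‖
      ≤ |t| * √(2 * Q₁) + (ε * (1 + t ^ 2 * Real.exp (t ^ 2 * (s + 1)) * (s + A))
        + (2 * |t| ^ 3 * L + (t ^ 2 / 2 + 2) * A) / (2 * ε)) := by
  have hf := hX.memLp_of_integrable_pow_four hfm hf4
  have hnpos : (0 : ℝ) < n := by positivity
  have hr : 0 < √(n : ℝ) := Real.sqrt_pos.2 hnpos
  have hr2 : √(n : ℝ) ^ 2 = n := Real.sq_sqrt hnpos.le
  set ξ : ℕ → Ω → ℝ := fun k ω => 1 / √n * innovation μ X f k ω with hξ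
  have hDm : ∀ k : ℕ, Measurable[pastSigma X ((k + 1 : ℕ) : ℤ)] (innovation μ X f k) := fun k => by
    rw [Nat.cast_succ]
    exact measurable_innovation hfm k
  have hξ3 : ∀ (k : ℕ) ω, |ξ k ω| ^ 3 = (1 / √n) ^ 3 * |innovation μ X f k ω| ^ 3 := fun k ω => by
    rw [hξ]
    simp only [abs_mul, mul_pow, abs_of_pos (one_div_pos.2 hr)]
  have hξ2 : ∀ ω, ∑ k ∈ Finset.range n, ξ k ω ^ 2 - s
      = (n : ℝ)⁻¹ * ∑ k ∈ Finset.range n, innovation μ X f k ω ^ 2 - s := fun ω => by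
    simp only [hξ, mul_pow, one_div, inv_pow, hr2, ← Finset.mul_sum]
  have hclt := norm_integral_cexp_sub_le (μ := μ) (ξ := ξ) (F := fun k : ℕ => pastSigma X k)
    (fun k => hX.pastSigma_le k) (fun i j h => monotone_pastSigma X (Int.ofNat_le.2 h))
    (fun k => (hDm k).const_mul _) (fun k => (hX.memLp_innovation hf k).const_mul _)
    (fun k => by
      simp_rw [hξ3]
      exact (hX.innovation_abs_pow_three hfm hf4 hmean k).1.const_mul _)
    (fun k => by
      refine (condExp_smul (1 / √n) (innovation μ X f k) (pastSigma X k)).trans ?_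
      filter_upwards [hX.condExp_innovation hf k] with ω h
      rw [Pi.smul_apply, h, Pi.zero_apply, smul_zero]) hs hε t n
  have hAb : ∫ ω, |∑ k ∈ Finset.range n, ξ k ω ^ 2 - s| ∂μ ≤ A := by
    simp_rw [hξ2]
    rw [hA, hQ₂, hc, hm]
    exact hX.integral_abs_sum_sq_innovation_sub_le hfm hf4 hmean hn s
  have hLb : ∑ k ∈ Finset.range n, ∫ ω, |ξ k ω| ^ 3 ∂μ ≤ L := by
    simp_rw [hξ3, integral_const_mul]
    refine (Finset.sum_le_sum fun (k : ℕ) _ => mul_le_mul_of_nonneg_left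
      (hX.innovation_abs_pow_three hfm hf4 hmean k).2 (pow_nonneg (one_div_pos.2 hr).le 3)).trans ?_
    rw [Finset.sum_const, Finset.card_range, nsmul_eq_mul, ← hm, ← hc, hL]
    have h4 := hX.inv_mul_integral_pow_four_le hfm hf4 n
    rw [← hQ₂, ← hm] at h4
    have e : (n : ℝ) * ((1 / √n) ^ 3 * (√(2 * (m + c)) * √(16 * ∫ ω, f (X 0 ω) ^ 4 ∂μ)))
        = √(2 * (m + c)) * √(16 * (1 / (n : ℝ) * ∫ ω, f (X 0 ω) ^ 4 ∂μ)) := by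
      rw [mul_left_comm 16, Real.sqrt_mul (x := 1 / (n : ℝ)) (by positivity), Real.sqrt_div zero_le_one,
        Real.sqrt_one]
      nth_rw 1 [← hr2]
      field_simp
    rw [e]
    gcongr
  have hsumS : ∀ ω, ∑ k ∈ Finset.Icc 1 n, f (X (k : ℤ) ω)
      = ∑ k ∈ Finset.range n, f (X ((k : ℤ) + 1) ω) := fun ω => by
    rw [← Finset.Ico_succ_right_eq_Icc, Finset.sum_Ico_eq_sum_range]
    refine Finset.sum_congr rfl fun k _ => ?_
    rw [Nat.cast_add, Nat.cast_one, add_comm]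
  have hdiff : ∀ ω, 1 / √n * ∑ k ∈ Finset.Icc 1 n, f (X (k : ℤ) ω) - ∑ k ∈ Finset.range n, ξ k ω
      = 1 / √n * ∑ k ∈ Finset.range n, prediction μ X f k ω := fun ω => by
    rw [hsumS]
    simp only [hξ, innovation, Finset.sum_sub_distrib, ← Finset.mul_sum]
    ring
  have hpi : Integrable (fun ω => ∑ k ∈ Finset.range n, prediction μ X f k ω) μ :=
    integrable_finsetSum _ fun (k : ℕ) _ => (hX.memLp_prediction hf k).integrable (by norm_num)
  have hrem := norm_integral_cexp_sub_cexp_le (μ := μ)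
    (Y := fun ω => 1 / √n * ∑ k ∈ Finset.Icc 1 n, f (X (k : ℤ) ω))
    (Z := fun ω => ∑ k ∈ Finset.range n, ξ k ω)
    ((Finset.measurable_sum _ fun (k : ℕ) _ => hfm.comp (hX.meas k)).const_mul _)
    (Finset.aemeasurable_fun_sum _ fun (k : ℕ) _ =>
      ((hX.memLp_innovation hf k).aestronglyMeasurable.aemeasurable.const_mul _))
    (by simp_rw [hdiff]; exact hpi.const_mul _) t
  have hremb : ∫ ω, |1 / √n * ∑ k ∈ Finset.Icc 1 n, f (X (k : ℤ) ω)
      - ∑ k ∈ Finset.range n, ξ k ω| ∂μ ≤ √(2 * Q₁) := by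
    simp_rw [hdiff, abs_mul, abs_of_pos (one_div_pos.2 hr)]
    rw [integral_const_mul, hQ₁, hc]
    refine (mul_le_mul_of_nonneg_left (hX.integral_abs_sum_prediction_le hf hmean n)
      (by positivity)).trans (le_of_eq ?_)
    rw [← mul_assoc, one_div_mul_cancel hr.ne', one_mul]
  refine (norm_sub_le_norm_sub_add_norm_sub _ _ _).trans (add_le_add
    (hrem.trans (mul_le_mul_of_nonneg_left hremb (abs_nonneg t))) (hclt.trans ?_))
  gcongr

end IsStationaryReversibleMarkov

end RowBound

/-- Theorem 2: CLT for a triangular array of row-wise stationary reversible Markov chains. -/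
theorem clt_triangular_reversible {Ω : Type*} [MeasurableSpace Ω]
    (μ : Measure Ω) [IsProbabilityMeasure μ]
    (X : ℤ → Ω → ℝ) (hX : IsStationaryReversibleMarkov μ X)
    (fn : ℕ → ℝ → ℝ) (hfn_meas : ∀ n, Measurable (fn n))
    (σ2 : NNReal)
    -- `E X_{n,k}⁴ < ∞`
    (hmom4 : ∀ (n : ℕ) (k : ℤ), Integrable (fun ω => (fn n (X k ω)) ^ 4) μ)
    -- `E X_{n,k} = 0`
    (hmean0 : ∀ (n : ℕ) (k : ℤ), ∫ ω, fn n (X k ω) ∂μ = 0)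
    -- `E (X_{n,0}²) → σ²`
    (hvar : Tendsto (fun n : ℕ => ∫ ω, (fn n (X 0 ω)) ^ 2 ∂μ) atTop (nhds (σ2 : ℝ)))
    -- `cov(X_{n,0}, X_{n,2}) + ∑_{k=2}^n cov(X_{n,0}, X_{n,k}) → 0`
    (hcov : Tendsto (fun n : ℕ =>
        covR μ (fun ω => fn n (X 0 ω)) (fun ω => fn n (X 2 ω))
          + ∑ k ∈ Finset.Icc 2 n, covR μ (fun ω => fn n (X 0 ω)) (fun ω => fn n (X (k : ℤ) ω)))
      atTop (nhds 0))
    -- `(1/n)(var(X_{n,0}²) + ∑_{u=0}^n cov(X_{n,0}², X_{n,u}²)) → 0`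
    (hcov2 : Tendsto (fun n : ℕ => (1 / (n : ℝ))
        * (covR μ (fun ω => (fn n (X 0 ω)) ^ 2) (fun ω => (fn n (X 0 ω)) ^ 2)
          + ∑ u ∈ Finset.Icc 0 n,
              covR μ (fun ω => (fn n (X 0 ω)) ^ 2) (fun ω => (fn n (X (u : ℤ) ω)) ^ 2)))
      atTop (nhds 0)) :
    -- conclusion: `(1/√n) ∑_{k=1}^n X_{n,k} ⇒ N(0, σ²)`
    ∀ φ : BoundedContinuousFunction ℝ ℝ,
      Tendsto (fun n : ℕ => ∫ ω,
          φ ((1 / Real.sqrt n) * ∑ k ∈ Finset.Icc 1 n, fn n (X (k : ℤ) ω)) ∂μ)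
        atTop (nhds (∫ z, φ z ∂(gaussianReal 0 σ2))) := by
  have hfL : ∀ n, MemLp (fn n) 2 (μ.map (X 0)) := fun n =>
    hX.memLp_of_integrable_pow_four (hfn_meas n) (hmom4 n)
  have hYm : ∀ n : ℕ, Measurable fun ω =>
      (1 / Real.sqrt n) * ∑ k ∈ Finset.Icc 1 n, fn n (X (k : ℤ) ω) := fun n =>
    (Finset.measurable_sum _ fun (k : ℕ) _ => (hfn_meas n).comp (hX.meas k)).const_mul _
  set ν : ℕ → ProbabilityMeasure ℝ := fun n => ⟨μ.map fun ω =>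
    (1 / Real.sqrt n) * ∑ k ∈ Finset.Icc 1 n, fn n (X (k : ℤ) ω),
    Measure.isProbabilityMeasure_map (hYm n).aemeasurable⟩ with hν
  suffices h : Tendsto ν atTop (nhds ⟨gaussianReal 0 σ2, inferInstance⟩) by
    intro φ
    refine (ProbabilityMeasure.tendsto_iff_forall_integral_tendsto.1 h φ).congr fun n => ?_
    exact integral_map (hYm n).aemeasurable φ.continuous.aestronglyMeasurable
  refine ProbabilityMeasure.tendsto_iff_tendsto_charFun.2 fun t => ?_
  have hchar : charFun (gaussianReal 0 σ2) t = Complex.exp (-(t ^ 2 * σ2 / 2) : ℝ) := by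
    rw [charFun_gaussianReal]
    congr 1
    push_cast
    ring
  have hcharν : ∀ n, charFun (ν n : Measure ℝ) t = ∫ ω, Complex.exp
      ((t * (1 / Real.sqrt n * ∑ k ∈ Finset.Icc 1 n, fn n (X (k : ℤ) ω)) : ℝ)
        * Complex.I) ∂μ := fun n => by
    rw [charFun_apply_real, hν]
    refine (integral_map (hYm n).aemeasurable (by fun_prop)).trans ?_
    push_cast
    rfl
  simp only [ProbabilityMeasure.coe_mk]
  simp_rw [hchar, hcharν]
  set m : ℕ → ℝ := fun n => ∫ ω, fn n (X 0 ω) ^ 2 ∂μ with hm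
  set c : ℕ → ℝ := fun n => covR μ (fun ω => fn n (X 0 ω)) (fun ω => fn n (X 2 ω)) with hc
  set Q₁ : ℕ → ℝ := fun n => c n
    + ∑ k ∈ Finset.Icc 2 n, covR μ (fun ω => fn n (X 0 ω)) (fun ω => fn n (X (k : ℤ) ω)) with hQ₁
  set Q₂ : ℕ → ℝ := fun n => (1 / (n : ℝ))
        * (covR μ (fun ω => (fn n (X 0 ω)) ^ 2) (fun ω => (fn n (X 0 ω)) ^ 2)
          + ∑ u ∈ Finset.Icc 0 n,
              covR μ (fun ω => (fn n (X 0 ω)) ^ 2) (fun ω => (fn n (X (u : ℤ) ω)) ^ 2)) with hQ₂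
  have hc0 : Tendsto c atTop (nhds 0) :=
    squeeze_zero (fun n => hX.covR_two_nonneg (hfL n) (hmean0 n 0))
      (fun n => le_add_of_nonneg_right (hX.sum_covR_nonneg (hfL n) (hmean0 n 0) n)) hcov
  set A : ℕ → ℝ := fun n => c n + 2 * (√(m n) * √(c n)) + √(2 * Q₂ n) + |m n - σ2| with hA
  set L : ℕ → ℝ := fun n => √(2 * (m n + c n)) * √(16 * (Q₂ n + 1 / (n : ℝ) * m n ^ 2)) with hL
  have hA0 : Tendsto A atTop (nhds 0) := by
    have h := ((hc0.add ((hvar.sqrt.mul hc0.sqrt).const_mul 2)).add (hcov2.const_mul 2).sqrt).add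
      (hvar.sub_const (σ2 : ℝ)).abs
    simpa [hA] using h
  have hL0 : Tendsto L atTop (nhds 0) := by
    have h := ((hvar.add hc0).const_mul 2).sqrt.mul
      ((hcov2.add (tendsto_one_div_atTop_nhds_zero_nat.mul (hvar.pow 2))).const_mul 16).sqrt
    simpa [hL] using h
  rw [tendsto_iff_norm_sub_tendsto_zero]
  set K : ℝ := 1 + t ^ 2 * Real.exp (t ^ 2 * (σ2 + 1)) * σ2 with hK
  have hKpos : 0 < K := by positivity
  refine Metric.tendsto_nhds.2 fun δ hδ => ?_
  set ε : ℝ := δ / (2 * K) with hε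
  have hεpos : 0 < ε := by positivity
  have hlim : Tendsto (fun n => |t| * √(2 * Q₁ n)
      + (ε * (1 + t ^ 2 * Real.exp (t ^ 2 * (σ2 + 1)) * (σ2 + A n))
        + (2 * |t| ^ 3 * L n + (t ^ 2 / 2 + 2) * A n) / (2 * ε))) atTop (nhds (ε * K)) := by
    have h := ((hcov.const_mul 2).sqrt.const_mul |t|).add
      ((((((hA0.const_add (σ2 : ℝ)).const_mul
        (t ^ 2 * Real.exp (t ^ 2 * (σ2 + 1)))).const_add 1).const_mul ε)).add
      (((hL0.const_mul (2 * |t| ^ 3)).add (hA0.const_mul (t ^ 2 / 2 + 2))).div_const (2 * ε)))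
    simpa using h
  have hlt : ε * K < δ := by
    rw [hε]
    field_simp
    norm_num
  filter_upwards [hlim.eventually_lt_const hlt, eventually_ne_atTop 0] with n h1 h2
  rw [Real.dist_0_eq_abs, abs_norm]
  exact (hX.norm_integral_cexp_sum_sub_le (hfn_meas n) (hmom4 n) (hmean0 n 0) h2 σ2.2 hεpos t
    rfl rfl rfl rfl rfl rfl).trans_lt h1
end
end

section
/- Let (X_n)_{n∈ℤ} be a strictly stationary reversible real-valued Markov chain, g square-integrable with ∫ g dπ = 0, and Y_i = g(X_i). Then for every positive integer ℓ and every integer n ≥ 2ℓ, max_{2ℓ ≤ j ≤ n} ∑_{k=2ℓ}^{j} E(Y_0 Y_k) ≤ ∑_{k=2ℓ}^{n} E(Y_0 Y_k) + E(Y_0 Y_{2ℓ}). -/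
open MeasureTheory ProbabilityTheory Filter

noncomputable section

theorem sum_range_nonneg_of_add_succ_nonneg {c : ℕ → ℝ} (h0 : ∀ i, 0 ≤ c (2 * i))
    (h1 : ∀ i, 0 ≤ c (2 * i) + c (2 * i + 1)) (m a : ℕ) :
    0 ≤ ∑ k ∈ Finset.range m, c (2 * a + k) := by
  induction m using Nat.twoStepInduction generalizing a with
  | zero => simp
  | one => simpa using h0 a
  | more m ih _ =>
    rw [Finset.sum_range_succ', Finset.sum_range_succ']
    have h := ih (a + 1)
    have he : ∑ k ∈ Finset.range m, c (2 * (a + 1) + k)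
        = ∑ k ∈ Finset.range m, c (2 * a + (k + 1 + 1)) :=
      Finset.sum_congr rfl fun k _ => by congr 1; ring
    have := h1 a
    simp only [zero_add, add_zero]
    linarith

theorem sum_Icc_le_sum_Icc_add {c : ℕ → ℝ} (h0 : ∀ i, 0 ≤ c (2 * i))
    (h1 : ∀ i, 0 ≤ c (2 * i) + c (2 * i + 1)) (h2 : ∀ i, c (2 * (i + 1)) ≤ c (2 * i))
    {l j n : ℕ} (hlj : 2 * l ≤ j) (hjn : j ≤ n) :
    ∑ k ∈ Finset.Icc (2 * l) j, c k ≤ ∑ k ∈ Finset.Icc (2 * l) n, c k + c (2 * l) := by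
  obtain ⟨d, rfl⟩ := Nat.exists_eq_add_of_le hjn
  have hsplit : ∑ k ∈ Finset.Icc (2 * l) (j + d), c k
      = ∑ k ∈ Finset.Icc (2 * l) j, c k + ∑ k ∈ Finset.range d, c (j + 1 + k) := by
    have hI : ∀ b, Finset.Icc (2 * l) b = Finset.Ico (2 * l) (b + 1) := fun b => by
      ext; simp
    rw [hI, hI, ← Finset.sum_Ico_consecutive c (show 2 * l ≤ j + 1 by omega)
      (show j + 1 ≤ j + d + 1 by omega), Finset.sum_Ico_eq_sum_range c (j + 1)]
    congr 3
    omega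
  rw [hsplit]
  rcases Nat.even_or_odd' j with ⟨a, rfl | rfl⟩
  · have hanti : c (2 * a) ≤ c (2 * l) :=
      antitone_nat_of_succ_le (f := fun i => c (2 * i)) h2 (by omega)
    have h := sum_range_nonneg_of_add_succ_nonneg h0 h1 (d + 1) a
    rw [Finset.sum_range_succ', add_zero] at h
    have he : ∑ k ∈ Finset.range d, c (2 * a + (k + 1))
        = ∑ k ∈ Finset.range d, c (2 * a + 1 + k) :=
      Finset.sum_congr rfl fun k _ => by congr 1; ring
    linarith
  · have h := sum_range_nonneg_of_add_succ_nonneg h0 h1 d (a + 1)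
    have := h0 l
    have he : 2 * (a + 1) = 2 * a + 1 + 1 := by ring
    rw [he] at h
    linarith

namespace IsStationaryReversibleMarkov

variable {Ω : Type*} [MeasurableSpace Ω] {μ : Measure Ω} {X : ℤ → Ω → ℝ}

theorem integral_shift (hX : IsStationaryReversibleMarkov μ X) {F : (ℤ → ℝ) → ℝ}
    (hF : Measurable F) (n : ℤ) :
    ∫ ω, F (fun k => X (k + n) ω) ∂μ = ∫ ω, F (fun k => X k ω) ∂μ := by
  have hshift (m : ℤ) : Measurable fun ω => fun k : ℤ => X (k + m) ω :=
    measurable_pi_lambda _ fun k => hX.meas _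
  have h0 : Measurable fun ω => fun k : ℤ => X k ω := measurable_pi_lambda _ hX.meas
  rw [← integral_map (hshift n).aemeasurable hF.aestronglyMeasurable, hX.stationary,
    integral_map h0.aemeasurable hF.aestronglyMeasurable]

theorem integral_shift_one (hX : IsStationaryReversibleMarkov μ X) {f : ℝ → ℝ}
    (hf : Measurable f) (n : ℤ) : ∫ ω, f (X n ω) ∂μ = ∫ ω, f (X 0 ω) ∂μ := by
  simpa using hX.integral_shift (F := fun x => f (x 0)) (by fun_prop) n

theorem integral_shift_two (hX : IsStationaryReversibleMarkov μ X) {φ f : ℝ → ℝ}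
    (hφ : Measurable φ) (hf : Measurable f) (n : ℤ) :
    ∫ ω, φ (X n ω) * f (X (n + 1) ω) ∂μ = ∫ ω, φ (X 0 ω) * f (X 1 ω) ∂μ := by
  simpa [add_comm] using hX.integral_shift (F := fun x => φ (x 0) * f (x 1)) (by fun_prop) n

theorem integral_mul_comm (hX : IsStationaryReversibleMarkov μ X) {φ f : ℝ → ℝ}
    (hφ : Measurable φ) (hf : Measurable f) :
    ∫ ω, φ (X 0 ω) * f (X 1 ω) ∂μ = ∫ ω, f (X 0 ω) * φ (X 1 ω) ∂μ := by
  have hF : Measurable fun p : ℝ × ℝ => φ p.1 * f p.2 := by fun_prop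
  have h := integral_map (μ := μ) ((hX.meas 0).prodMk (hX.meas 1)).aemeasurable
    hF.aestronglyMeasurable
  rw [hX.reversible, integral_map ((hX.meas 1).prodMk (hX.meas 0)).aemeasurable
    hF.aestronglyMeasurable] at h
  simp only [mul_comm] at h ⊢
  exact h.symm

theorem measurable_pastSigma (X : ℤ → Ω → ℝ) {j k : ℤ} (hjk : j ≤ k) :
    Measurable[pastSigma X k] (X j) :=
  measurable_iff_comap_le.2 <|
    le_iSup₂_of_le (f := fun j (_ : j ≤ k) => MeasurableSpace.comap (X j) inferInstance)
      j hjk le_rfl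

theorem tendsto_integral_clip (hX : IsStationaryReversibleMarkov μ X) {g : ℝ → ℝ}
    (hg : Measurable g) (hg2 : Integrable (fun x => g x ^ 2) (μ.map (X 0))) (k : ℤ) :
    Tendsto (fun N : ℕ => ∫ ω, max (-(N : ℝ)) (min N (g (X 0 ω)))
      * max (-(N : ℝ)) (min N (g (X k ω))) ∂μ) atTop (nhds (∫ ω, g (X 0 ω) * g (X k ω) ∂μ)) := by
  have hm := hX.meas
  have hmap : μ.map (X k) = μ.map (X 0) := by
    have h := congrArg (Measure.map fun x : ℤ → ℝ => x 0) (hX.stationary k)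
    rw [Measure.map_map (by fun_prop) (by fun_prop), Measure.map_map (by fun_prop) (by fun_prop)]
      at h
    simpa [Function.comp_def] using h
  have hsq0 : Integrable (fun ω => g (X 0 ω) ^ 2) μ := hg2.comp_measurable (hm 0)
  have hsqk : Integrable (fun ω => g (X k ω) ^ 2) μ := by
    rw [← hmap] at hg2
    exact hg2.comp_measurable (hm k)
  have habs (N : ℕ) (x : ℝ) : |max (-(N : ℝ)) (min N x)| ≤ |x| := by
    have hN : (0 : ℝ) ≤ N := N.cast_nonneg
    refine abs_le.2 ⟨?_, max_le (by linarith [abs_nonneg x])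
      ((min_le_right _ _).trans (le_abs_self x))⟩
    exact le_max_of_le_right (le_min (by linarith [abs_nonneg x]) (neg_abs_le x))
  have hlim (x : ℝ) : Tendsto (fun N : ℕ => max (-(N : ℝ)) (min N x)) atTop (nhds x) := by
    refine tendsto_const_nhds.congr' ?_
    filter_upwards [tendsto_natCast_atTop_atTop.eventually_ge_atTop |x|] with N hN
    rw [min_eq_right ((le_abs_self x).trans hN), max_eq_right (by linarith [neg_abs_le x])]
  refine tendsto_integral_of_dominated_convergence
    (fun ω => g (X 0 ω) ^ 2 + g (X k ω) ^ 2) (fun N => by fun_prop) (hsq0.add hsqk) ?_ ?_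
  · refine fun N => ae_of_all _ fun ω => ?_
    rw [Real.norm_eq_abs, abs_mul]
    refine (mul_le_mul (habs N _) (habs N _) (abs_nonneg _) (abs_nonneg _)).trans ?_
    rw [← sq_abs (g (X 0 ω)), ← sq_abs (g (X k ω))]
    nlinarith [sq_nonneg (|g (X 0 ω)| - |g (X k ω)|), sq_nonneg (g (X 0 ω)), sq_nonneg (g (X k ω)),
      sq_abs (g (X 0 ω)), sq_abs (g (X k ω))]
  · exact ae_of_all _ fun ω => (hlim _).mul (hlim _)

variable [IsProbabilityMeasure μ]

theorem integrable_of_abs_le_one {f : Ω → ℝ} (hf : Measurable f)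
    (h1 : ∀ x, |f x| ≤ 1) : Integrable f μ :=
  .of_bound hf.aestronglyMeasurable 1 (ae_of_all _ h1)

/-- A bounded version of the one-step transition operator applied to `f`. -/
theorem exists_transition (hX : IsStationaryReversibleMarkov μ X) {f : ℝ → ℝ}
    (hf : Measurable f) (hf1 : ∀ x, |f x| ≤ 1) :
    ∃ h : ℝ → ℝ, Measurable h ∧ (∀ x, |h x| ≤ 1) ∧ ∀ n : ℤ,
      (fun ω => h (X n ω)) =ᵐ[μ] μ[fun ω => f (X (n + 1) ω) | pastSigma X n] := by
  have hfi (k : ℤ) : Integrable (fun ω => f (X k ω)) μ :=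
    integrable_of_abs_le_one (hf.comp (hX.meas k)) fun _ => hf1 _
  obtain ⟨h', hh', he⟩ := (stronglyMeasurable_condExp (μ := μ)
    (m := MeasurableSpace.comap (X 0) inferInstance)
    (f := fun ω => f (X (0 + 1) ω))).measurable.exists_eq_measurable_comp
  have hb : ∀ᵐ ω ∂μ, |h' (X 0 ω)| ≤ 1 := by
    have := ae_bdd_abs_condExp_of_ae_bdd_abs (μ := μ) (R := (1 : ℝ))
      (m := MeasurableSpace.comap (X 0) inferInstance)
      (f := fun ω => f (X (0 + 1) ω)) (ae_of_all _ fun _ => hf1 _)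
    rwa [he] at this
  let h : ℝ → ℝ := fun x => max (-1) (min 1 (h' x))
  have hh : Measurable h := by fun_prop
  have hh1 (x : ℝ) : |h x| ≤ 1 :=
    abs_le.2 ⟨le_max_left _ _, max_le (by norm_num) (min_le_left _ _)⟩
  have hhi (k : ℤ) : Integrable (fun ω => h (X k ω)) μ :=
    integrable_of_abs_le_one (hh.comp (hX.meas k)) fun _ => hh1 _
  have hae : (fun ω => h (X 0 ω)) =ᵐ[μ]
      μ[fun ω => f (X (0 + 1) ω) | MeasurableSpace.comap (X 0) inferInstance] := by
    rw [he]
    filter_upwards [hb] with ω hω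
    simp [h, (abs_le.1 hω).1, (abs_le.1 hω).2]
  have hset (k : ℤ) {B : Set ℝ} (hB : MeasurableSet B) (u : Ω → ℝ) :
      ∫ ω in X k ⁻¹' B, u ω ∂μ = ∫ ω, B.indicator 1 (X k ω) * u ω ∂μ := by
    rw [← integral_indicator (hX.meas k hB)]
    congr 1 with ω
    by_cases hω : X k ω ∈ B <;> simp [hω]
  refine ⟨h, hh, hh1, fun n => .trans ?_ (hX.markov n f hf hf1).symm⟩
  refine ae_eq_condExp_of_forall_setIntegral_eq (hX.meas n).comap_le (hfi _)
    (fun _ _ _ => (hhi n).integrableOn) ?_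
    (hh.comp (comap_measurable (X n))).stronglyMeasurable.aestronglyMeasurable
  rintro _ ⟨B, hB, rfl⟩ -
  have hBm : Measurable (B.indicator (1 : ℝ → ℝ)) := measurable_one.indicator hB
  rw [hset n hB, hset n hB, hX.integral_shift_two hBm hf,
    hX.integral_shift_one (f := fun x => B.indicator 1 x * h x) (by fun_prop) n,
    ← hset 0 hB, ← hset 0 hB, setIntegral_congr_ae (hX.meas 0 hB) (hae.mono fun _ h _ => h),
    setIntegral_condExp (hX.meas 0).comap_le (hfi _) ⟨B, hB, rfl⟩]
  rfl

theorem exists_transition_integral (hX : IsStationaryReversibleMarkov μ X) {f : ℝ → ℝ}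
    (hf : Measurable f) (hf1 : ∀ x, |f x| ≤ 1) :
    ∃ h : ℝ → ℝ, (Measurable h ∧ ∀ x, |h x| ≤ 1) ∧
      ∀ φ : ℝ → ℝ, Measurable φ → (∀ x, |φ x| ≤ 1) → ∀ n : ℕ,
        ∫ ω, φ (X 0 ω) * f (X ((n + 1 : ℕ) : ℤ) ω) ∂μ = ∫ ω, φ (X 0 ω) * h (X (n : ℤ) ω) ∂μ := by
  obtain ⟨h, hh, hh1, hc⟩ := hX.exists_transition hf hf1
  refine ⟨h, ⟨hh, hh1⟩, fun φ hφ hφ1 n => ?_⟩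
  have hpull := condExp_stronglyMeasurable_mul_of_bound (hX.pastSigma_le n)
    (f := fun ω => φ (X 0 ω)) (g := fun ω => f (X (n + 1) ω))
    (hφ.comp (measurable_pastSigma X (Int.natCast_nonneg n))).stronglyMeasurable
    (integrable_of_abs_le_one (hf.comp (hX.meas (n + 1))) fun _ => hf1 _) 1
    (ae_of_all μ fun _ => hφ1 _)
  have hint := integral_condExp (μ := μ) (hX.pastSigma_le n)
    (f := (fun ω => φ (X 0 ω)) * fun ω => f (X (n + 1) ω))
  rw [integral_congr_ae hpull] at hint
  push_cast
  refine hint.symm.trans (integral_congr_ae ?_)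
  filter_upwards [hc n] with ω hω
  simp [hω]

theorem integral_sq_eq (hX : IsStationaryReversibleMarkov μ X) {u v : ℝ → ℝ}
    (hu : Measurable u) (hu1 : ∀ x, |u x| ≤ 1) (hv : Measurable v) (hv1 : ∀ x, |v x| ≤ 1) :
    ∫ ω, (u (X 0 ω) + v (X 1 ω)) ^ 2 ∂μ = ∫ ω, u (X 0 ω) * u (X 0 ω) ∂μ
      + 2 * ∫ ω, u (X 0 ω) * v (X 1 ω) ∂μ + ∫ ω, v (X 0 ω) * v (X 0 ω) ∂μ := by
  have hm := hX.meas
  have hi {a b : ℝ → ℝ} (ha : Measurable a) (ha1 : ∀ x, |a x| ≤ 1) (hb : Measurable b)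
      (hb1 : ∀ x, |b x| ≤ 1) (j k : ℤ) : Integrable (fun ω => a (X j ω) * b (X k ω)) μ :=
    integrable_of_abs_le_one (by fun_prop) fun ω => by
      rw [abs_mul]; exact mul_le_one₀ (ha1 _) (abs_nonneg _) (hb1 _)
  rw [← hX.integral_shift_one (f := fun x => v x * v x) (by fun_prop) 1, ← integral_const_mul,
    ← integral_add (hi hu hu1 hu hu1 0 0) ((hi hu hu1 hv hv1 0 1).const_mul 2),
    ← integral_add (by exact (hi hu hu1 hu hu1 0 0).add ((hi hu hu1 hv hv1 0 1).const_mul 2))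
      (hi hv hv1 hv hv1 1 1)]
  congr 1 with ω
  ring

theorem cov_ineqs_of_abs_le_one (hX : IsStationaryReversibleMarkov μ X) {f : ℝ → ℝ}
    (hf : Measurable f) (hf1 : ∀ x, |f x| ≤ 1) (i : ℕ) :
    0 ≤ ∫ ω, f (X 0 ω) * f (X (2 * i : ℕ) ω) ∂μ ∧
    0 ≤ ∫ ω, f (X 0 ω) * f (X (2 * i : ℕ) ω) ∂μ
      + ∫ ω, f (X 0 ω) * f (X (2 * i + 1 : ℕ) ω) ∂μ ∧
    ∫ ω, f (X 0 ω) * f (X (2 * (i + 1) : ℕ) ω) ∂μ ≤ ∫ ω, f (X 0 ω) * f (X (2 * i : ℕ) ω) ∂μ := by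
  choose! T hT hTint using
    fun (u : ℝ → ℝ) (hu : Measurable u ∧ ∀ x, |u x| ≤ 1) =>
      hX.exists_transition_integral hu.1 hu.2
  let G (k : ℕ) : ℝ → ℝ := T^[k] f
  have hGs (k : ℕ) : G (k + 1) = T (G k) := Function.iterate_succ_apply' _ _ _
  have hG (k : ℕ) : Measurable (G k) ∧ ∀ x, |G k x| ≤ 1 := by
    induction k with
    | zero => exact ⟨hf, hf1⟩
    | succ k ih => rw [hGs]; exact hT _ ih
  have hstep (i k n : ℕ) : ∫ ω, G i (X 0 ω) * G k (X (n + 1 : ℕ) ω) ∂μ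
      = ∫ ω, G i (X 0 ω) * G (k + 1) (X (n : ℕ) ω) ∂μ := by
    rw [hGs]; exact hTint _ (hG k) _ (hG i).1 (hG i).2 n
  have hone (i k : ℕ) : ∫ ω, G i (X 0 ω) * G k (X 1 ω) ∂μ
      = ∫ ω, G i (X 0 ω) * G (k + 1) (X 0 ω) ∂μ := by
    simpa using hstep i k 0
  have hmove (i k : ℕ) : ∫ ω, G i (X 0 ω) * G (k + 1) (X 0 ω) ∂μ
      = ∫ ω, G (i + 1) (X 0 ω) * G k (X 0 ω) ∂μ := by
    rw [← hone, hX.integral_mul_comm (hG i).1 (hG k).1, hone]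
    simp only [mul_comm]
  have hcov (k n : ℕ) : ∫ ω, f (X 0 ω) * G k (X (n : ℕ) ω) ∂μ
      = ∫ ω, f (X 0 ω) * G (k + n) (X 0 ω) ∂μ := by
    induction n generalizing k with
    | zero => simp
    | succ n ih =>
      have h := hstep 0 k n
      simp only [show G 0 = f from rfl] at h
      rw [h, ih, show k + 1 + n = k + (n + 1) by ring]
  have hprod (i k : ℕ) : ∫ ω, f (X 0 ω) * f (X (i + k : ℕ) ω) ∂μ
      = ∫ ω, G i (X 0 ω) * G k (X 0 ω) ∂μ := by
    have h0 := hcov 0 (i + k)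
    rw [show G 0 = f from rfl] at h0
    rw [h0]
    clear h0
    induction i generalizing k with
    | zero => simp [G]
    | succ i ih =>
      rw [← hmove, ← ih (k + 1)]
      congr! 5
      ring
  have e0 := hprod i i
  have e1 := hprod i (i + 1)
  have e2 := hprod (i + 1) (i + 1)
  rw [show 2 * i = i + i by ring, show 2 * (i + 1) = (i + 1) + (i + 1) by ring,
    show i + i + 1 = i + (i + 1) by ring, e0, e1, e2]
  refine ⟨integral_nonneg fun ω => mul_self_nonneg _, ?_, ?_⟩
  · have h := hX.integral_sq_eq (hG i).1 (hG i).2 (hG i).1 (hG i).2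
    have : 0 ≤ ∫ ω, (G i (X 0 ω) + G i (X 1 ω)) ^ 2 ∂μ := integral_nonneg fun ω => sq_nonneg _
    rw [hone] at h
    linarith
  · have h := hX.integral_sq_eq (hG (i + 1)).1 (hG (i + 1)).2 (v := fun x => -G i x)
      (hG i).1.neg fun x => by simpa using (hG i).2 x
    have : 0 ≤ ∫ ω, (G (i + 1) (X 0 ω) + -G i (X 1 ω)) ^ 2 ∂μ :=
      integral_nonneg fun ω => sq_nonneg _
    simp only [mul_neg, neg_mul, neg_neg, integral_neg, hone] at h
    linarith

theorem cov_ineqs (hX : IsStationaryReversibleMarkov μ X) {g : ℝ → ℝ}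
    (hg : Measurable g) (hg2 : Integrable (fun x => g x ^ 2) (μ.map (X 0))) (i : ℕ) :
    0 ≤ ∫ ω, g (X 0 ω) * g (X (2 * i : ℕ) ω) ∂μ ∧
    0 ≤ ∫ ω, g (X 0 ω) * g (X (2 * i : ℕ) ω) ∂μ
      + ∫ ω, g (X 0 ω) * g (X (2 * i + 1 : ℕ) ω) ∂μ ∧
    ∫ ω, g (X 0 ω) * g (X (2 * (i + 1) : ℕ) ω) ∂μ ≤ ∫ ω, g (X 0 ω) * g (X (2 * i : ℕ) ω) ∂μ := by
  let c (N k : ℕ) : ℝ := ∫ ω, max (-(N : ℝ)) (min N (g (X 0 ω)))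
    * max (-(N : ℝ)) (min N (g (X k ω))) ∂μ
  have hlim (k : ℕ) : Tendsto (fun N => c N k) atTop (nhds (∫ ω, g (X 0 ω) * g (X k ω) ∂μ)) :=
    hX.tendsto_integral_clip hg hg2 k
  have hc (N : ℕ) :
      0 ≤ c N (2 * i) ∧ 0 ≤ c N (2 * i) + c N (2 * i + 1) ∧ c N (2 * (i + 1)) ≤ c N (2 * i) := by
    rcases N.eq_zero_or_pos with rfl | hN
    · simp [c]
    have hN' : (0 : ℝ) < N := Nat.cast_pos.2 hN
    have hscale (k : ℕ) : c N k = N ^ 2 * ∫ ω, max (-(N : ℝ)) (min N (g (X 0 ω))) / N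
        * (max (-(N : ℝ)) (min N (g (X k ω))) / N) ∂μ := by
      rw [← integral_const_mul]
      refine integral_congr_ae (ae_of_all _ fun ω => ?_)
      field_simp
    obtain ⟨h0, h1, h2⟩ := hX.cov_ineqs_of_abs_le_one
      (f := fun x => max (-(N : ℝ)) (min N (g x)) / N) (by fun_prop)
      (fun x => by
        rw [abs_div, Nat.abs_cast, div_le_one hN']
        exact abs_le.2 ⟨le_max_left _ _, max_le (by linarith) (min_le_left _ _)⟩) i
    rw [hscale, hscale, hscale, ← mul_add]
    exact ⟨by positivity, mul_nonneg (by positivity) h1,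
      mul_le_mul_of_nonneg_left h2 (by positivity)⟩
  exact ⟨ge_of_tendsto' (hlim _) fun N => (hc N).1,
    ge_of_tendsto' ((hlim _).add (hlim _)) fun N => (hc N).2.1,
    le_of_tendsto_of_tendsto' (hlim _) (hlim _) fun N => (hc N).2.2⟩

end IsStationaryReversibleMarkov

/-- Lemma 1, relation (12): for `ℓ ≥ 1` and `n ≥ 2ℓ`,
`max_{2ℓ ≤ j ≤ n} ∑_{k=2ℓ}^j E(Y_0 Y_k) ≤ ∑_{k=2ℓ}^n E(Y_0 Y_k) + E(Y_0 Y_{2ℓ})`. -/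
theorem max_sum_cov_le {Ω : Type*} [MeasurableSpace Ω]
    (μ : Measure Ω) [IsProbabilityMeasure μ]
    (X : ℤ → Ω → ℝ) (hX : IsStationaryReversibleMarkov μ X)
    (g : ℝ → ℝ) (hg_meas : Measurable g)
    (hg_sq : Integrable (fun x => g x ^ 2) (μ.map (X 0)))
    (hg_mean : ∫ x, g x ∂(μ.map (X 0)) = 0)
    (ℓ : ℕ) (hℓ : 1 ≤ ℓ) (n : ℕ) (hn : 2 * ℓ ≤ n) :
    (Finset.Icc (2 * ℓ) n).sup' (Finset.nonempty_Icc.mpr hn)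
        (fun j => ∑ k ∈ Finset.Icc (2 * ℓ) j, ∫ ω, g (X 0 ω) * g (X (k : ℤ) ω) ∂μ)
      ≤ (∑ k ∈ Finset.Icc (2 * ℓ) n, ∫ ω, g (X 0 ω) * g (X (k : ℤ) ω) ∂μ)
        + ∫ ω, g (X 0 ω) * g (X (2 * (ℓ : ℤ)) ω) ∂μ := by
  refine Finset.sup'_le _ _ fun j hj => ?_
  obtain ⟨hlj, hjn⟩ := Finset.mem_Icc.1 hj
  have h := sum_Icc_le_sum_Icc_add (c := fun k : ℕ => ∫ ω, g (X 0 ω) * g (X (k : ℤ) ω) ∂μ)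
    (fun i => (hX.cov_ineqs hg_meas hg_sq i).1) (fun i => (hX.cov_ineqs hg_meas hg_sq i).2.1)
    (fun i => (hX.cov_ineqs hg_meas hg_sq i).2.2) hlj hjn
  simpa using h
end
end
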